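/- For every integer n ≥ 66 with n ≡ 2 (mod 8) there exists a cyclically 5-connected strictly critical snark of order n whose girth equals 6. -/

import Mathlib

/-- The colour set `K = (ℤ₂ × ℤ₂) ∖ {(0,0)}`. -/
abbrev Kol : Type := {x : ZMod 2 × ZMod 2 // x ≠ 0}

/-- A proper edge colouring: distinct edges sharing a vertex get distinct colours. -/
def IsProperEdgeColoring {V C : Type*} (G : SimpleGraph V) (f : Sym2 V → C) : Prop :=
  ∀ e₁ ∈ G.edgeSet, ∀ e₂ ∈ G.edgeSet, e₁ ≠ e₂ → (∃ v : V, v ∈ e₁ ∧ v ∈ e₂) → f e₁ ≠ f e₂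

/-- A graph is 3-edge-colourable if it has a proper edge colouring with three colours. -/
def ThreeEdgeColorable {V : Type*} (G : SimpleGraph V) : Prop :=
  ∃ f : Sym2 V → Kol, IsProperEdgeColoring G f

/-- A graph is cubic if every vertex has degree 3. -/
def IsCubic {V : Type*} (G : SimpleGraph V) : Prop :=
  ∀ v : V, (G.neighborSet v).ncard = 3

/-- A snark: a connected cubic simple graph which is not 3-edge-colourable. -/
def IsSnark {V : Type*} (G : SimpleGraph V) : Prop :=
  G.Connected ∧ IsCubic G ∧ ¬ ThreeEdgeColorable G

/-- A snark is critical if removing any two distinct adjacent vertices yields a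
3-edge-colourable graph. -/
def Critical {V : Type*} (G : SimpleGraph V) : Prop :=
  ∀ u v : V, G.Adj u v → ThreeEdgeColorable (G.induce ({u, v}ᶜ : Set V))

/-- A snark is bicritical if removing any two distinct vertices yields a
3-edge-colourable graph. -/
def Bicritical {V : Type*} (G : SimpleGraph V) : Prop :=
  ∀ u v : V, u ≠ v → ThreeEdgeColorable (G.induce ({u, v}ᶜ : Set V))

/-- Strictly critical: critical but not bicritical. -/
def StrictlyCritical {V : Type*} (G : SimpleGraph V) : Prop :=
  Critical G ∧ ¬ Bicritical G

/-- A cubic graph is cyclically `k`-connected if no set of fewer than `k` edges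
separates two cycles, i.e. there is no set `F` of fewer than `k` edges whose deletion
leaves a graph in which two connected components contain a cycle. -/
def CyclicallyConnected {V : Type*} (G : SimpleGraph V) (k : ℕ) : Prop :=
  ¬ ∃ F : Set (Sym2 V), F ⊆ G.edgeSet ∧ F.ncard < k ∧
    ∃ a b : V, (∃ w : (G.deleteEdges F).Walk a a, w.IsCycle) ∧
               (∃ w : (G.deleteEdges F).Walk b b, w.IsCycle) ∧
               ¬ (G.deleteEdges F).Reachable a b

/-- The cyclic connectivity of a cubic graph: the largest `k` (at most the number of
edges) such that the graph is cyclically `k`-connected. -/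
noncomputable def cyclicConnectivity {V : Type*} (G : SimpleGraph V) : ℕ :=
  sSup {k | k ≤ G.edgeSet.ncard ∧ CyclicallyConnected G k}

/-- Neighbours in the smallest graph of the family, of order 66. -/
def baseNbr : List (Fin 3 → ℕ) :=
  [![1, 2, 19], ![0, 4, 22], ![0, 5, 16], ![20, 7, 6], ![1, 8, 6], ![2, 9, 6],
   ![3, 4, 5], ![3, 11, 10], ![4, 12, 10], ![5, 13, 10], ![7, 8, 9], ![7, 15, 14],
   ![8, 16, 14], ![9, 17, 14], ![11, 12, 13], ![11, 21, 18], ![12, 2, 18], ![13, 23, 18],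
   ![15, 16, 17], ![0, 24, 47], ![3, 27, 50], ![15, 39, 62], ![1, 43, 46], ![17, 44, 45],
   ![19, 25, 26], ![24, 28, 43], ![24, 29, 40], ![20, 31, 30], ![25, 32, 30], ![26, 33, 30],
   ![27, 28, 29], ![27, 35, 34], ![28, 36, 34], ![29, 37, 34], ![31, 32, 33], ![31, 39, 38],
   ![32, 40, 38], ![33, 41, 38], ![35, 36, 37], ![35, 21, 42], ![36, 26, 42], ![37, 44, 42],
   ![39, 40, 41], ![22, 25, 45], ![23, 41, 46], ![23, 43, 48], ![22, 44, 64], ![19, 48, 49],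
   ![45, 47, 51], ![47, 52, 63], ![20, 54, 53], ![48, 55, 53], ![49, 56, 53], ![50, 51, 52],
   ![50, 58, 57], ![51, 59, 57], ![52, 60, 57], ![54, 55, 56], ![54, 62, 61], ![55, 63, 61],
   ![56, 64, 61], ![58, 59, 60], ![58, 21, 65], ![59, 49, 65], ![60, 46, 65], ![62, 63, 64]]

/-- The position of `v` among the neighbours of its `i`-th neighbour, in the smallest graph. -/
def baseRev : List (Fin 3 → Fin 3) :=
  [![0, 0, 0], ![0, 0, 0], ![1, 0, 1], ![0, 0, 0], ![1, 0, 1], ![1, 0, 2],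
   ![2, 2, 2], ![1, 0, 0], ![1, 0, 1], ![1, 0, 2], ![2, 2, 2], ![1, 0, 0],
   ![1, 0, 1], ![1, 0, 2], ![2, 2, 2], ![1, 0, 0], ![1, 2, 1], ![1, 0, 2],
   ![2, 2, 2], ![2, 0, 0], ![0, 0, 0], ![1, 1, 1], ![2, 0, 0], ![1, 0, 0],
   ![1, 0, 0], ![1, 0, 1], ![2, 0, 1], ![1, 0, 0], ![1, 0, 1], ![1, 0, 2],
   ![2, 2, 2], ![1, 0, 0], ![1, 0, 1], ![1, 0, 2], ![2, 2, 2], ![1, 0, 0],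
   ![1, 0, 1], ![1, 0, 2], ![2, 2, 2], ![1, 1, 0], ![1, 2, 1], ![1, 1, 2],
   ![2, 2, 2], ![1, 2, 1], ![1, 1, 1], ![2, 2, 0], ![2, 2, 1], ![2, 1, 0],
   ![2, 1, 0], ![2, 0, 1], ![2, 0, 0], ![2, 0, 1], ![1, 0, 2], ![2, 2, 2],
   ![1, 0, 0], ![1, 0, 1], ![1, 0, 2], ![2, 2, 2], ![1, 0, 0], ![1, 0, 1],
   ![1, 0, 2], ![2, 2, 2], ![1, 2, 0], ![1, 2, 1], ![1, 2, 2], ![2, 2, 2]]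

/-- The `i`-th neighbour of `v` in the graph of order `66 + 4 * d`, in which the last chain of
claws, starting at the vertex `50`, has `4 + d` claws. -/
def nbr (d v : ℕ) (i : Fin 3) : ℕ :=
  if v < 54 then
    let t := baseNbr.getD v 0 i
    if t < 62 then t else t + 4 * d
  else if v < 62 + 4 * d then
    if (v + 2) % 4 = 3 then v - 3 + i
    else if i = 0 then v - 4 else if i = 1 then v + 4 else v + 3 - (v + 2) % 4
  else
    let t := baseNbr.getD (v - 4 * d) 0 i
    if t < 58 then t else t + 4 * d

/-- The position of `v` among the neighbours of its `i`-th neighbour. -/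
def nbrRev (d v : ℕ) (i : Fin 3) : Fin 3 :=
  if v < 54 then baseRev.getD v 0 i
  else if v < 62 + 4 * d then
    if (v + 2) % 4 = 3 then 2
    else if i = 0 then 1 else if i = 1 then 0 else Fin.ofNat 3 ((v + 2) % 4)
  else baseRev.getD (v - 4 * d) 0 i

theorem nbr_of_lt {d v : ℕ} (h : v < 54) (i : Fin 3) :
    nbr d v i = if baseNbr.getD v 0 i < 62 then baseNbr.getD v 0 i
      else baseNbr.getD v 0 i + 4 * d := by
  simp [nbr, h]

theorem nbr_add {d v : ℕ} (h : 62 ≤ v) (i : Fin 3) :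
    nbr d (v + 4 * d) i = if baseNbr.getD v 0 i < 58 then baseNbr.getD v 0 i
      else baseNbr.getD v 0 i + 4 * d := by
  have h1 : ¬ v + 4 * d < 54 := by omega
  have h2 : ¬ v + 4 * d < 62 + 4 * d := by omega
  simp [nbr, h1, h2]

theorem nbr_center {d j : ℕ} (h : j < d + 2) (i : Fin 3) :
    nbr d (4 * j + 57) i = 4 * j + 54 + i := by
  have h1 : ¬ 4 * j + 57 < 54 := by omega
  have h2 : 4 * j + 57 < 62 + 4 * d := by omega
  have h3 : (4 * j + 57 + 2) % 4 = 3 := by omega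
  simp only [nbr, h1, h2, h3, if_true, if_false]
  omega

theorem nbr_leaf {d j : ℕ} (h : j < d + 2) (r i : Fin 3) :
    nbr d (4 * j + 54 + r) i = ![4 * j + 50 + r, 4 * j + 58 + r, 4 * j + 57] i := by
  have hr := r.isLt
  have h1 : ¬ 4 * j + 54 + (r : ℕ) < 54 := by omega
  have h2 : 4 * j + 54 + (r : ℕ) < 62 + 4 * d := by omega
  have h3 : (4 * j + 54 + (r : ℕ) + 2) % 4 = r := by omega
  have h4 : (r : ℕ) ≠ 3 := by omega
  simp only [nbr, h1, h2, h3, h4, if_true, if_false]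
  fin_cases i <;> simp <;> omega

theorem nbrRev_of_lt {d v : ℕ} (h : v < 54) (i : Fin 3) :
    nbrRev d v i = baseRev.getD v 0 i := by
  simp [nbrRev, h]

theorem nbrRev_add {d v : ℕ} (h : 62 ≤ v) (i : Fin 3) :
    nbrRev d (v + 4 * d) i = baseRev.getD v 0 i := by
  have h1 : ¬ v + 4 * d < 54 := by omega
  have h2 : ¬ v + 4 * d < 62 + 4 * d := by omega
  simp [nbrRev, h1, h2]

theorem nbrRev_center {d j : ℕ} (h : j < d + 2) (i : Fin 3) :
    nbrRev d (4 * j + 57) i = 2 := by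
  have h1 : ¬ 4 * j + 57 < 54 := by omega
  have h2 : 4 * j + 57 < 62 + 4 * d := by omega
  have h3 : (4 * j + 57 + 2) % 4 = 3 := by omega
  simp only [nbrRev, h1, h2, h3, if_true, if_false]

theorem nbrRev_leaf {d j : ℕ} (h : j < d + 2) (r i : Fin 3) :
    nbrRev d (4 * j + 54 + r) i = ![1, 0, r] i := by
  have hr := r.isLt
  have h1 : ¬ 4 * j + 54 + (r : ℕ) < 54 := by omega
  have h2 : 4 * j + 54 + (r : ℕ) < 62 + 4 * d := by omega
  have h3 : (4 * j + 54 + (r : ℕ) + 2) % 4 = r := by omega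
  have h4 : (r : ℕ) ≠ 3 := by omega
  simp only [nbrRev, h1, h2, h3, h4, if_true, if_false]
  fin_cases i <;> simp

/-- Every vertex lies in the fixed part, is a centre or a leaf of an inner claw of the chain, or
belongs to the last claw. -/
theorem vertex_cases {d : ℕ} {P : ℕ → Prop} (hlow : ∀ v < 54, P v)
    (hcenter : ∀ j < d + 2, P (4 * j + 57))
    (hleaf : ∀ j < d + 2, ∀ r : Fin 3, P (4 * j + 54 + r))
    (hhigh : ∀ v, 62 ≤ v → v < 66 → P (v + 4 * d)) {v : ℕ} (hv : v < 66 + 4 * d) : P v := by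
  by_cases h1 : v < 54
  · exact hlow v h1
  by_cases h2 : v < 62 + 4 * d
  · obtain ⟨j, r, hr, rfl⟩ : ∃ j r, r < 4 ∧ v = 4 * j + 54 + r :=
      ⟨(v - 54) / 4, (v - 54) % 4, by omega, by omega⟩
    by_cases h3 : r = 3
    · subst h3
      exact hcenter j (by omega)
    · exact hleaf j (by omega) ⟨r, by omega⟩
  · obtain ⟨w, rfl⟩ : ∃ w, v = w + 4 * d := ⟨v - 4 * d, by omega⟩
    exact hhigh w (by omega) (by omega)

theorem nbr_lt {d v : ℕ} (hv : v < 66 + 4 * d) (i : Fin 3) : nbr d v i < 66 + 4 * d := by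
  have hb : ∀ v < 66, ∀ i, baseNbr.getD v 0 i < 66 := by decide +kernel
  refine vertex_cases (P := fun v => nbr d v i < 66 + 4 * d) (fun v hv => ?_) (fun j hj => ?_)
    (fun j hj r => ?_) (fun v h1 h2 => ?_) hv
  · have := hb v (by omega) i
    rw [nbr_of_lt hv]
    split_ifs <;> omega
  · rw [nbr_center hj]
    omega
  · rw [nbr_leaf hj]
    fin_cases i <;> (simp; omega)
  · have := hb v (by omega) i
    rw [nbr_add h1]
    split_ifs <;> omega

theorem nbr_injective {d v : ℕ} (hv : v < 66 + 4 * d) : Function.Injective (nbr d v) := by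
  have hb : ∀ v < 66, ∀ i j, baseNbr.getD v 0 i = baseNbr.getD v 0 j → i = j := by
    decide +kernel
  refine vertex_cases (P := fun v => Function.Injective (nbr d v)) (fun v hv i k h => ?_)
    (fun j hj i k h => ?_) (fun j hj r i k h => ?_) (fun v h1 h2 i k h => ?_) hv
  · apply hb v (by omega)
    rw [nbr_of_lt hv, nbr_of_lt hv] at h
    split_ifs at h <;> omega
  · rw [nbr_center hj, nbr_center hj] at h
    omega
  · have := r.isLt
    rw [nbr_leaf hj, nbr_leaf hj] at h
    fin_cases i <;> fin_cases k <;> simp at h ⊢ <;> omega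
  · apply hb v (by omega)
    rw [nbr_add h1, nbr_add h1] at h
    split_ifs at h <;> omega

theorem nbr_nbrRev {d v : ℕ} (hv : v < 66 + 4 * d) (i : Fin 3) :
    nbr d (nbr d v i) (nbrRev d v i) = v := by
  have hlo : ∀ v < 54, ∀ i, (baseNbr.getD v 0 i < 54 ∧ v < 62 ∧
        baseNbr.getD (baseNbr.getD v 0 i) 0 (baseRev.getD v 0 i) = v) ∨
      (∃ r : Fin 3, baseNbr.getD v 0 i = 54 + r ∧ baseRev.getD v 0 i = 0 ∧ v = 50 + r) ∨
      (62 ≤ baseNbr.getD v 0 i ∧ v < 58 ∧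
        baseNbr.getD (baseNbr.getD v 0 i) 0 (baseRev.getD v 0 i) = v) := by
    decide +kernel
  have hhi : ∀ v < 66, 62 ≤ v → ∀ i, (baseNbr.getD v 0 i < 54 ∧
        baseNbr.getD (baseNbr.getD v 0 i) 0 (baseRev.getD v 0 i) = v) ∨
      (∃ r : Fin 3, baseNbr.getD v 0 i = 58 + r ∧ baseRev.getD v 0 i = 1 ∧ v = 62 + r) ∨
      (62 ≤ baseNbr.getD v 0 i ∧
        baseNbr.getD (baseNbr.getD v 0 i) 0 (baseRev.getD v 0 i) = v) := by
    decide +kernel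
  refine vertex_cases (P := fun v => nbr d (nbr d v i) (nbrRev d v i) = v) (fun v hv => ?_)
    (fun j hj => ?_) (fun j hj r => ?_) (fun v h1 h2 => ?_) hv
  · rw [nbr_of_lt hv, nbrRev_of_lt hv]
    rcases hlo v hv i with ⟨h, h', h''⟩ | ⟨r, h, h', h''⟩ | ⟨h, h', h''⟩
    · rw [if_pos (by omega), nbr_of_lt h, h'', if_pos h']
    · have := r.isLt
      rw [h, h', if_pos (by omega), ← Nat.zero_add 54, ← Nat.mul_zero 4, nbr_leaf (by omega), h'']
      simp
    · rw [if_neg (by omega), nbr_add h, h'', if_pos h']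
  · rw [nbr_center hj, nbrRev_center hj, nbr_leaf hj]
    simp
  · have hr := r.isLt
    rw [nbr_leaf hj, nbrRev_leaf hj]
    fin_cases i
    · rcases j with _ | j
      · have h : ∀ r : Fin 3, baseNbr.getD (50 + r) 0 1 = 54 + r := by decide
        have := h r
        simp [nbr_of_lt (d := d) (show 50 + (r : ℕ) < 54 by omega), -List.getD_eq_getElem?_getD,
          this]
        omega
      · have := nbr_leaf (d := d) (j := j) (by omega) r 1
        simp at this ⊢
        rw [show 4 * (j + 1) + 50 + (r : ℕ) = 4 * j + 54 + r by omega, this]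
        omega
    · by_cases h : j + 1 < d + 2
      · have := nbr_leaf (d := d) h r 0
        simp at this ⊢
        rw [show 4 * j + 58 + (r : ℕ) = 4 * (j + 1) + 54 + r by omega, this]
        omega
      · have h : ∀ r : Fin 3, baseNbr.getD (62 + r) 0 0 = 58 + r := by decide
        have h2 := h r
        have h3 := nbr_add (d := d) (v := 62 + r) (by omega) 0
        simp [-List.getD_eq_getElem?_getD] at h3 ⊢
        rw [show 4 * j + 58 + (r : ℕ) = 62 + r + 4 * d by omega, h3, h2, if_neg (by omega)]
        omega
    · have := nbr_center hj r
      simpa using this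
  · rw [nbr_add h1, nbrRev_add h1]
    rcases hhi v h2 h1 i with ⟨h, h'⟩ | ⟨r, h, h', h''⟩ | ⟨h, h'⟩
    · rw [if_pos (by omega), nbr_of_lt h, h', if_neg (by omega)]
    · have := r.isLt
      rw [h, h', if_neg (by omega), show 58 + (r : ℕ) + 4 * d = 4 * (d + 1) + 54 + r by omega,
        nbr_leaf (by omega), h'']
      simp
      omega
    · rw [if_neg (by omega), nbr_add h, h', if_neg (by omega)]

theorem nbr_ne {d v : ℕ} (hv : v < 66 + 4 * d) (i : Fin 3) : nbr d v i ≠ v := by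
  have hb : ∀ v < 66, ∀ i, baseNbr.getD v 0 i ≠ v := by decide +kernel
  refine vertex_cases (P := fun v => nbr d v i ≠ v) (fun v hv => ?_)
    (fun j hj => ?_) (fun j hj r => ?_) (fun v h1 h2 => ?_) hv
  · have := hb v (by omega) i
    rw [nbr_of_lt hv]
    split_ifs <;> omega
  · rw [nbr_center hj]
    omega
  · rw [nbr_leaf hj]
    fin_cases i <;> simp <;> omega
  · have := hb v (by omega) i
    rw [nbr_add h1]
    split_ifs <;> omega

/-- The graph of order `66 + 4 * d`. -/
def chainGraph (d : ℕ) : SimpleGraph (Fin (66 + 4 * d)) where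
  Adj v w := ∃ i, nbr d v i = w
  symm := ⟨fun v w ⟨i, h⟩ => ⟨nbrRev d v i, by rw [← h]; exact nbr_nbrRev v.isLt i⟩⟩
  loopless := ⟨fun v ⟨i, h⟩ => nbr_ne v.isLt i h⟩

theorem chainGraph_adj {d : ℕ} {v w : Fin (66 + 4 * d)} :
    (chainGraph d).Adj v w ↔ ∃ i, nbr d v i = w :=
  Iff.rfl

/-- The `i`-th neighbour of `v` as a vertex of `chainGraph d`. -/
def nb {d : ℕ} (v : Fin (66 + 4 * d)) (i : Fin 3) : Fin (66 + 4 * d) :=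
  ⟨nbr d v i, nbr_lt v.isLt i⟩

theorem nb_injective {d : ℕ} (v : Fin (66 + 4 * d)) : Function.Injective (nb v) :=
  fun _ _ h => nbr_injective v.isLt (congrArg Fin.val h)

theorem chainGraph_adj_iff {d : ℕ} {v w : Fin (66 + 4 * d)} :
    (chainGraph d).Adj v w ↔ ∃ i, nb v i = w := by
  simp [chainGraph_adj, nb, Fin.ext_iff]

theorem isCubic_chainGraph (d : ℕ) : IsCubic (chainGraph d) := by
  intro v
  have : (chainGraph d).neighborSet v = Set.range (nb v) := by
    ext w
    simp [chainGraph_adj_iff]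
  rw [this, ← Set.image_univ, Set.ncard_image_of_injective _ (nb_injective v)]
  simp

/-! ### The chain of claws starting at the vertex `50` -/

theorem nbr_chain_center {d j : ℕ} (h : j < d + 4) (i : Fin 3) :
    nbr d (50 + 4 * j + 3) i = 50 + 4 * j + i := by
  have h0 : ∀ i : Fin 3, baseNbr.getD 53 0 i = 50 + i := by decide
  have h1 : ∀ i : Fin 3, baseNbr.getD 65 0 i = 62 + i := by decide
  rcases Nat.eq_zero_or_pos j with rfl | hj
  · rw [nbr_of_lt (by omega), h0, if_pos (by omega)]
  by_cases h' : j = d + 3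
  · subst h'
    rw [show 50 + 4 * (d + 3) + 3 = 65 + 4 * d by omega, nbr_add (by omega), h1,
      if_neg (by omega)]
    omega
  · obtain ⟨k, rfl⟩ : ∃ k, j = k + 1 := ⟨j - 1, by omega⟩
    rw [show 50 + 4 * (k + 1) + 3 = 4 * k + 57 by omega, nbr_center (by omega)]
    omega

theorem nbr_chain_leaf_two {d j : ℕ} (h : j < d + 4) (r : Fin 3) :
    nbr d (50 + 4 * j + r) 2 = 50 + 4 * j + 3 := by
  have h0 : ∀ r : Fin 3, baseNbr.getD (50 + r) 0 2 = 53 := by decide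
  have h1 : ∀ r : Fin 3, baseNbr.getD (62 + r) 0 2 = 65 := by decide
  have hr := r.isLt
  rcases Nat.eq_zero_or_pos j with rfl | hj
  · rw [nbr_of_lt (by omega), h0, if_pos (by omega)]
  by_cases h' : j = d + 3
  · subst h'
    rw [show 50 + 4 * (d + 3) + (r : ℕ) = 62 + r + 4 * d by omega, nbr_add (by omega), h1,
      if_neg (by omega)]
    omega
  · obtain ⟨k, rfl⟩ : ∃ k, j = k + 1 := ⟨j - 1, by omega⟩
    rw [show 50 + 4 * (k + 1) + (r : ℕ) = 4 * k + 54 + r by omega, nbr_leaf (by omega)]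
    simp
    omega

theorem nbr_chain_leaf_one {d j : ℕ} (h : j + 1 < d + 4) (r : Fin 3) :
    nbr d (50 + 4 * j + r) 1 = 50 + 4 * (j + 1) + r := by
  have h0 : ∀ r : Fin 3, baseNbr.getD (50 + r) 0 1 = 54 + r := by decide
  have hr := r.isLt
  rcases Nat.eq_zero_or_pos j with rfl | hj
  · rw [nbr_of_lt (by omega), h0, if_pos (by omega)]
  · obtain ⟨k, rfl⟩ : ∃ k, j = k + 1 := ⟨j - 1, by omega⟩
    rw [show 50 + 4 * (k + 1) + (r : ℕ) = 4 * k + 54 + r by omega, nbr_leaf (by omega)]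
    simp
    omega

theorem nbr_chain_leaf_zero {d j : ℕ} (h : j + 1 < d + 4) (r : Fin 3) :
    nbr d (50 + 4 * (j + 1) + r) 0 = 50 + 4 * j + r := by
  have h1 : ∀ r : Fin 3, baseNbr.getD (62 + r) 0 0 = 58 + r := by decide
  have hr := r.isLt
  by_cases h' : j = d + 2
  · subst h'
    rw [show 50 + 4 * (d + 2 + 1) + (r : ℕ) = 62 + r + 4 * d by omega, nbr_add (by omega), h1,
      if_neg (by omega)]
    omega
  · rw [show 50 + 4 * (j + 1) + (r : ℕ) = 4 * j + 54 + r by omega, nbr_leaf (by omega)]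
    simp
    omega

theorem nbr_first (d : ℕ) (r : Fin 3) : nbr d (50 + r) 0 = ![20, 48, 49] r := by
  have h0 : ∀ r : Fin 3, baseNbr.getD (50 + r) 0 0 = ![20, 48, 49] r ∧ ![20, 48, 49] r < 62 := by
    decide
  rw [nbr_of_lt (by omega), (h0 r).1, if_pos (h0 r).2]

theorem nbr_last (d : ℕ) (r : Fin 3) :
    nbr d (50 + 4 * (d + 3) + r) 1 = ![21, 49, 46] r := by
  have h0 : ∀ r : Fin 3, baseNbr.getD (62 + r) 0 1 = ![21, 49, 46] r ∧ ![21, 49, 46] r < 58 := by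
    decide
  rw [show 50 + 4 * (d + 3) + (r : ℕ) = 62 + r + 4 * d by omega, nbr_add (by omega), (h0 r).1,
    if_pos (h0 r).2]

/-- The ends in the fixed part of the edges leaving it. -/
theorem nbr_low {v : ℕ} (hv : v < 50) (i : Fin 3) :
    (baseNbr.getD v 0 i < 50 ∧ ∀ d, nbr d v i = baseNbr.getD v 0 i) ∨
    (∃ r : Fin 3, ∀ d, nbr d v i = 50 + r) ∨
    (∃ r : Fin 3, ∀ d, nbr d v i = 50 + 4 * (d + 3) + r) := by
  have hb : ∀ v < 50, ∀ i, baseNbr.getD v 0 i < 50 ∨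
      (∃ r : Fin 3, baseNbr.getD v 0 i = 50 + r) ∨
      (∃ r : Fin 3, baseNbr.getD v 0 i = 62 + r) := by decide +kernel
  rcases hb v hv i with h | ⟨r, h⟩ | ⟨r, h⟩
  · exact .inl ⟨h, fun d => by rw [nbr_of_lt (by omega), if_pos (by omega)]⟩
  · exact .inr (.inl ⟨r, fun d => by rw [nbr_of_lt (by omega), h, if_pos (by omega)]⟩)
  · exact .inr (.inr ⟨r, fun d => by rw [nbr_of_lt (by omega), h, if_neg (by omega)]; omega⟩)

/-- Every vertex lies in the fixed part or is a centre or a leaf of a claw of the chain. -/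
theorem chain_cases {d : ℕ} {P : ℕ → Prop} (hlow : ∀ v < 50, P v)
    (hcenter : ∀ j < d + 4, P (50 + 4 * j + 3))
    (hleaf : ∀ j < d + 4, ∀ r : Fin 3, P (50 + 4 * j + r)) {v : ℕ} (hv : v < 66 + 4 * d) :
    P v := by
  by_cases h1 : v < 50
  · exact hlow v h1
  obtain ⟨j, r, hr, rfl⟩ : ∃ j r, r < 4 ∧ v = 50 + 4 * j + r :=
    ⟨(v - 50) / 4, (v - 50) % 4, by omega, by omega⟩
  by_cases h3 : r = 3
  · subst h3
    exact hcenter j (by omega)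
  · exact hleaf j (by omega) ⟨r, by omega⟩

/-! ### Removing two consecutive claws -/

/-- The relabelling of the vertices when the claws `p` and `p + 1` of the chain are removed. -/
def contract (p v : ℕ) : ℕ := if v < 50 + 4 * p then v else v - 8

theorem nbr_contract {d p v : ℕ} (hp : p ≤ d + 4) (hv : v < 66 + 4 * (d + 2)) {i : Fin 3}
    (h1 : v < 50 + 4 * p ∨ 58 + 4 * p ≤ v)
    (h2 : nbr (d + 2) v i < 50 + 4 * p ∨ 58 + 4 * p ≤ nbr (d + 2) v i) :
    nbr d (contract p v) i = contract p (nbr (d + 2) v i) := by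
  revert h1 h2
  refine chain_cases (P := fun v => (v < 50 + 4 * p ∨ 58 + 4 * p ≤ v) →
    (nbr (d + 2) v i < 50 + 4 * p ∨ 58 + 4 * p ≤ nbr (d + 2) v i) →
    nbr d (contract p v) i = contract p (nbr (d + 2) v i)) ?_ ?_ ?_ hv
  · intro v hv _ h2
    have hc : contract p v = v := if_pos (by omega)
    rw [hc]
    rcases nbr_low hv i with ⟨h, h'⟩ | ⟨r, h'⟩ | ⟨r, h'⟩
    · rw [h', h', contract, if_pos (by omega)]
    · rw [h'] at h2
      rw [h', h', contract, if_pos (by omega)]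
    · rw [h'] at h2
      rw [h', h', contract, if_neg (by omega)]
      omega
  · intro j hj h1 _
    rw [nbr_chain_center hj]
    by_cases h : j < p
    · rw [contract, if_pos (by omega), nbr_chain_center (by omega), contract, if_pos (by omega)]
    · obtain ⟨k, rfl⟩ : ∃ k, j = k + 2 := ⟨j - 2, by omega⟩
      rw [contract, if_neg (by omega), show 50 + 4 * (k + 2) + 3 - 8 = 50 + 4 * k + 3 by omega,
        nbr_chain_center (by omega), contract, if_neg (by omega)]
      omega
  · intro j hj r h1 h2
    have hr := r.isLt
    have hi : i = 0 ∨ i = 1 ∨ i = 2 := by omega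
    by_cases h : j < p
    · rw [contract, if_pos (by omega)]
      rcases hi with rfl | rfl | rfl
      · rcases j with _ | j
        · rw [Nat.mul_zero, Nat.add_zero, nbr_first, nbr_first, contract, if_pos]
          have : ∀ r, (![20, 48, 49] : Fin 3 → ℕ) r < 50 := by decide
          have := this r
          omega
        · rw [nbr_chain_leaf_zero hj, nbr_chain_leaf_zero (by omega), contract,
            if_pos (by omega)]
      · rw [nbr_chain_leaf_one (by omega)] at h2 ⊢
        rw [nbr_chain_leaf_one (by omega), contract, if_pos (by omega)]
      · rw [nbr_chain_leaf_two (by omega), nbr_chain_leaf_two (by omega), contract,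
          if_pos (by omega)]
    · obtain ⟨k, rfl⟩ : ∃ k, j = k + 2 := ⟨j - 2, by omega⟩
      rw [contract, if_neg (by omega),
        show 50 + 4 * (k + 2) + (r : ℕ) - 8 = 50 + 4 * k + r by omega]
      rcases hi with rfl | rfl | rfl
      · rw [nbr_chain_leaf_zero (by omega)] at h2 ⊢
        obtain ⟨l, rfl⟩ : ∃ l, k = l + 1 := ⟨k - 1, by omega⟩
        rw [nbr_chain_leaf_zero (by omega), contract, if_neg (by omega)]
        omega
      · by_cases hk : k = d + 3
        · subst hk
          rw [show d + 3 + 2 = d + 2 + 3 by omega, nbr_last, nbr_last, contract, if_pos]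
          have : ∀ r, (![21, 49, 46] : Fin 3 → ℕ) r < 50 := by decide
          have := this r
          omega
        · rw [nbr_chain_leaf_one (by omega), nbr_chain_leaf_one (by omega), contract,
            if_neg (by omega)]
          omega
      · rw [nbr_chain_leaf_two (by omega), nbr_chain_leaf_two (by omega), contract,
          if_neg (by omega)]
        omega

theorem contract_lt {d p v : ℕ} (hp : p ≤ d + 4) (hv : v < 66 + 4 * (d + 2)) :
    contract p v < 66 + 4 * d := by
  unfold contract
  split_ifs <;> omega

theorem contract_inj {p v w : ℕ} (hv : v < 50 + 4 * p ∨ 58 + 4 * p ≤ v)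
    (hw : w < 50 + 4 * p ∨ 58 + 4 * p ≤ w) (h : contract p v = contract p w) : v = w := by
  unfold contract at h
  split_ifs at h <;> omega

/-- Among sufficiently many claws, two consecutive ones avoid a given small set of vertices. -/
theorem exists_avoiding_claws (s : Finset ℕ) (m : ℕ) (h : s.card < m) :
    ∃ k < m, ∀ v ∈ s, v < 50 + 4 * (2 * k) ∨ 58 + 4 * (2 * k) ≤ v := by
  obtain ⟨k, hk, hk'⟩ : ∃ k ∈ Finset.range m, k ∉ s.image fun v => (v - 50) / 8 := by
    apply Finset.exists_mem_notMem_of_card_lt_card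
    simpa using Finset.card_image_le.trans_lt h
  refine ⟨k, Finset.mem_range.1 hk, fun v hv => ?_⟩
  by_contra hc
  exact hk' (Finset.mem_image.2 ⟨v, hv, by omega⟩)

/-! ### Girth -/

/-- The sequence `u` runs around a cycle of length `l`. -/
structure IsCircuit (d l : ℕ) (u : ℕ → ℕ) : Prop where
  lt : ∀ k, u k < 66 + 4 * d
  adj : ∀ k < l, ∃ i, nbr d (u k) i = u (k + 1)
  closed : u l = u 0
  inj : ∀ j < l, ∀ k < l, u j = u k → j = k

/-- No non-backtracking walk of at most `f` steps starting with `p`, `v` ends in `a`. -/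
def noReturn (d a : ℕ) : ℕ → ℕ → ℕ → Bool
  | 0, _, _ => true
  | f + 1, p, v => (List.finRange 3).all fun i =>
      let w := nbr d v i
      w == p || (w != a && noReturn d a f v w)

theorem IsCircuit.not_noReturn {d l : ℕ} {u : ℕ → ℕ} (h : IsCircuit d l u) (hl : 3 ≤ l) (f : ℕ) :
    ∀ k < l, l ≤ k + f → noReturn d (u 0) f (u (k - 1)) (u k) = false := by
  induction f with
  | zero => omega
  | succ f ih =>
    intro k hk hkf
    rw [← Bool.not_eq_true]
    intro hall
    obtain ⟨i, hi⟩ := h.adj k hk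
    have := List.all_eq_true.1 hall i (List.mem_finRange i)
    simp only [hi, Bool.or_eq_true, beq_iff_eq, Bool.and_eq_true, bne_iff_ne] at this
    by_cases hk' : k + 1 = l
    · rw [hk', h.closed] at this
      rcases this with h' | h'
      · have := h.inj 0 (by omega) (k - 1) (by omega) h'
        omega
      · exact h'.1 rfl
    · rcases this with h' | h'
      · have := h.inj (k + 1) (by omega) (k - 1) (by omega) h'
        omega
      · have := ih (k + 1) (by omega) (by omega)
        rw [Nat.add_sub_cancel] at this
        rw [this] at h'
        exact absurd h'.2 (by simp)

theorem IsCircuit.contract {d l p : ℕ} {u : ℕ → ℕ} (h : IsCircuit (d + 2) l u) (hp : p ≤ d + 4)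
    (hl : 0 < l) (hu : ∀ k < l, u k < 50 + 4 * p ∨ 58 + 4 * p ≤ u k) :
    IsCircuit d l fun k => contract p (u k) where
  lt k := contract_lt hp (h.lt k)
  adj k hk := by
    obtain ⟨i, hi⟩ := h.adj k hk
    refine ⟨i, ?_⟩
    rw [nbr_contract hp (h.lt k) (hu k hk), hi]
    rw [hi]
    by_cases hk' : k + 1 = l
    · rw [hk', h.closed]
      exact hu 0 hl
    · exact hu _ (by omega)
  closed := by rw [h.closed]
  inj j hj k hk hjk := h.inj j hj k hk (contract_inj (hu j hj) (hu k hk) hjk)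

theorem not_isCircuit (c : ℕ) : ∀ (l : ℕ) (u : ℕ → ℕ), 3 ≤ l → l ≤ 5 →
    ¬ IsCircuit (2 * c) l u := by
  induction c with
  | zero =>
    intro l u h3 h5 h
    have hb : ∀ a < 66, noReturn 0 a 5 a a = true := by decide +kernel
    have := h.not_noReturn h3 5 0 (by omega) (by omega)
    simp [hb _ (h.lt 0)] at this
  | succ c ih =>
    intro l u h3 h5 h
    by_cases hc : 3 ≤ c
    · have hs : ((Finset.range l).image u).card < c + 3 :=
        Finset.card_image_le.trans_lt (by rw [Finset.card_range]; omega)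
      obtain ⟨k, hk, hk'⟩ := exists_avoiding_claws _ _ hs
      exact ih l _ h3 h5 (IsCircuit.contract (p := 2 * k) h (by omega) (by omega)
        fun j hj => hk' _ (Finset.mem_image_of_mem u (Finset.mem_range.2 hj)))
    · have hb : ∀ c < 3, ∀ a < 66 + 4 * (2 * (c + 1)), noReturn (2 * (c + 1)) a 5 a a = true := by
        decide +kernel
      have := h.not_noReturn h3 5 0 (by omega) (by omega)
      simp [hb _ (by omega) _ (h.lt 0)] at this

theorem egirth_chainGraph (c : ℕ) : (chainGraph (2 * c)).egirth = 6 := by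
  refine le_antisymm ?_ ?_
  · have hlt : ∀ k : Fin 6, ![45, 43, 22, 46, 44, 23] k < 50 := by decide
    let x (k : Fin 6) : Fin (66 + 4 * (2 * c)) := ⟨![45, 43, 22, 46, 44, 23] k, by
      have := hlt k
      omega⟩
    have hx : ∀ k, (chainGraph (2 * c)).Adj (x k) (x (k + 1)) := by
      have hb : ∀ k : Fin 6, ∃ i, baseNbr.getD (![45, 43, 22, 46, 44, 23] k) 0 i =
          ![45, 43, 22, 46, 44, 23] (k + 1) := by decide
      intro k
      obtain ⟨i, hi⟩ := hb k
      refine ⟨i, ?_⟩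
      have h1 := hlt k
      have h2 := hlt (k + 1)
      simp only [x]
      rw [nbr_of_lt (by omega), hi, if_pos (by omega)]
    have hinj : Function.Injective x := by
      have hb : Function.Injective (![45, 43, 22, 46, 44, 23] : Fin 6 → ℕ) := by decide
      exact fun i j h => hb (congrArg Fin.val h)
    let w : (chainGraph (2 * c)).Walk (x 0) (x 0) :=
      .cons (hx 0) (.cons (hx 1) (.cons (hx 2) (.cons (hx 3) (.cons (hx 4) (.cons (hx 5) .nil)))))
    have hw : w.IsCycle := by
      rw [SimpleGraph.Walk.isCycle_def]
      refine ⟨?_, by simp [w], ?_⟩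
      · rw [SimpleGraph.Walk.isTrail_def]
        simp [w, hinj.eq_iff]
      · simp [w, hinj.eq_iff]
    have := SimpleGraph.egirth_le_length hw
    simpa [w] using this
  · rw [SimpleGraph.le_egirth]
    intro a w hw
    by_contra! hlt
    have h6 : w.length < 6 := by exact_mod_cast hlt
    refine not_isCircuit c w.length (fun k => w.getVert k) hw.three_le_length (by omega)
      ⟨fun k => (w.getVert k).isLt, fun k hk => w.adj_getVert_succ hk, by simp, ?_⟩
    intro j hj k hk h
    exact hw.getVert_injOn' (by simp; omega) (by simp; omega) (Fin.ext h)

/-! ### Small edge cuts -/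

/-- The neighbours of `v` preceding it. -/
def earlier (d v : ℕ) : List ℕ := ((List.finRange 3).map (nbr d v)).filter (· < v)

/-- The number of edges between `v` and earlier vertices on which `χ` is not constant. -/
def cutAt (d : ℕ) (χ : ℕ → Bool) (v : ℕ) : ℕ := (earlier d v).countP fun w => χ w != χ v

/-- A search tree. -/
inductive SearchTree
  | leaf : SearchTree
  | node : SearchTree → ℕ → SearchTree → SearchTree

namespace SearchTree

def insert (x : ℕ) : SearchTree → SearchTree
  | leaf => node leaf x leaf
  | node l y r => bif Nat.blt x y then node (l.insert x) y r
      else bif Nat.blt y x then node l y (r.insert x) else node l y r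

def all (p : ℕ → Bool) : SearchTree → Bool
  | leaf => true
  | node l y r => p y && l.all p && r.all p

/-- Insertion of all the values of `f` on `t` into `u`. -/
def insertAll (f : ℕ → SearchTree → SearchTree) : SearchTree → SearchTree → SearchTree
  | leaf, u => u
  | node l y r, u => insertAll f r (insertAll f l (f y u))

def Mem (x : ℕ) : SearchTree → Prop
  | leaf => False
  | node l y r => x = y ∨ l.Mem x ∨ r.Mem x

theorem mem_insert {x y : ℕ} {t : SearchTree} (h : x = y ∨ t.Mem x) : (t.insert y).Mem x := by
  induction t with
  | leaf => simpa [insert, Mem] using h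
  | node l z r hl hr =>
    have h1 : Nat.blt y z = decide (y < z) := by rw [Bool.eq_iff_iff]; simp [Nat.blt_eq]
    have h2 : Nat.blt z y = decide (z < y) := by rw [Bool.eq_iff_iff]; simp [Nat.blt_eq]
    rw [insert, h1, h2]
    by_cases h3 : y < z
    · simp only [h3, decide_true, cond_true, Mem] at h ⊢
      tauto
    by_cases h4 : z < y
    · simp only [h3, h4, decide_true, cond_true, decide_false, cond_false, Mem] at h ⊢
      tauto
    · have : y = z := by omega
      subst this
      simp only [h3, decide_false, cond_false, Mem] at h ⊢
      tauto

theorem of_all {p : ℕ → Bool} {t : SearchTree} (h : t.all p = true) {x : ℕ} (hx : t.Mem x) :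
    p x = true := by
  induction t with
  | leaf => exact hx.elim
  | node l y r hl hr =>
    simp only [all, Bool.and_eq_true] at h
    rcases hx with rfl | hx | hx
    · exact h.1.1
    · exact hl h.1.2 hx
    · exact hr h.2 hx

theorem mem_insertAll_of_mem {f : ℕ → SearchTree → SearchTree} {x : ℕ}
    (hf : ∀ y u, u.Mem x → (f y u).Mem x) (t : SearchTree) :
    ∀ u, u.Mem x → (insertAll f t u).Mem x := by
  induction t with
  | leaf => exact fun u hu => hu
  | node l y r hl hr => exact fun u hu => hr _ (hl _ (hf _ _ hu))

theorem mem_insertAll {f : ℕ → SearchTree → SearchTree} {x y : ℕ}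
    (hf : ∀ y u, u.Mem x → (f y u).Mem x) (hy : ∀ u, (f y u).Mem x) (t : SearchTree)
    (ht : t.Mem y) : ∀ u, (insertAll f t u).Mem x := by
  induction t with
  | leaf => exact ht.elim
  | node l z r hl hr =>
    intro u
    rcases ht with rfl | ht | ht
    · exact mem_insertAll_of_mem hf r _ (mem_insertAll_of_mem hf l _ (hy u))
    · exact mem_insertAll_of_mem hf r _ (hl ht _)
    · exact hr ht _

end SearchTree

/-- The vertices before `v` that have a neighbour not before `v`, as a bit mask. -/
def frontierMask (d v : ℕ) : ℕ :=
  Nat.ofBits fun w : Fin v => (List.finRange 3).any fun i => Nat.ble v (nbr d w i)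

/-- The code of a class of partial two-colourings: the restriction to the frontier as a bit mask
`m`, the number `c` of edges cut, and the numbers of vertices of each colour, capped at `3`. -/
def cutCode (m c a b : ℕ) : ℕ := m * 128 + c * 16 + a * 4 + b

/-- Extend a class of partial two-colourings by the colour `x` at `v`. -/
def extendCode (E : List ℕ) (F v s : ℕ) (x : Bool) (u : SearchTree) : SearchTree :=
  let c := s / 16 % 8 + E.countP fun w => (s / 128).testBit w != x
  bif Nat.ble c 4 then
    u.insert (cutCode ((s / 128 ||| x.toNat <<< v) &&& F) c (min 3 (s / 4 % 4 + x.toNat))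
      (min 3 (s % 4 + (!x).toNat)))
  else u

/-- The classes of two-colourings of the vertices up to `v` which cut at most four edges and have
the colour `false` at `0`. -/
def cutClasses (d : ℕ) : ℕ → SearchTree
  | 0 => SearchTree.leaf.insert (cutCode 0 0 0 1)
  | v + 1 => (cutClasses d v).insertAll
      (fun s u => extendCode (earlier d (v + 1)) (frontierMask d (v + 2)) (v + 1) s true
        (extendCode (earlier d (v + 1)) (frontierMask d (v + 2)) (v + 1) s false u)) .leaf

theorem cutCode_div {m c a b : ℕ} (hc : c < 8) (ha : a < 4) (hb : b < 4) :
    cutCode m c a b / 128 = m ∧ cutCode m c a b / 16 % 8 = c ∧ cutCode m c a b / 4 % 4 = a ∧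
      cutCode m c a b % 4 = b := by
  unfold cutCode
  omega

theorem testBit_frontierMask {d v w : ℕ} {i : Fin 3} (hw : w < v) (h : v ≤ nbr d w i) :
    (frontierMask d v).testBit w = true := by
  rw [frontierMask, Nat.testBit_ofBits_lt _ _ hw, List.any_eq_true]
  exact ⟨i, List.mem_finRange i, Nat.ble_eq_true_of_le h⟩

theorem mem_extendCode_of_mem {E : List ℕ} {F v s t : ℕ} {x : Bool} {u : SearchTree}
    (h : u.Mem t) : (extendCode E F v s x u).Mem t := by
  unfold extendCode
  dsimp only
  cases Nat.ble _ 4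
  · exact h
  · exact SearchTree.mem_insert (.inr h)

theorem exists_mem_cutClasses {d : ℕ} (χ : ℕ → Bool) (h0 : χ 0 = false) {v : ℕ}
    (hv : v < 66 + 4 * d) (hc : ∑ w ∈ Finset.range (v + 1), cutAt d χ w ≤ 4) :
    ∃ m, (cutClasses d v).Mem (cutCode m (∑ w ∈ Finset.range (v + 1), cutAt d χ w)
      (min 3 (Nat.count (fun w => χ w = true) (v + 1)))
      (min 3 (Nat.count (fun w => χ w = false) (v + 1)))) ∧
      m < 2 ^ (v + 1) ∧ ∀ w < v + 1, ∀ i, v + 1 ≤ nbr d w i → m.testBit w = χ w := by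
  induction v with
  | zero =>
    refine ⟨0, SearchTree.mem_insert (.inl ?_), by simp, ?_⟩
    · simp [h0, Nat.count_succ, cutAt, earlier]
    · intro w hw _ _
      obtain rfl : w = 0 := by omega
      simp [h0]
  | succ v ih =>
    rw [Finset.sum_range_succ] at hc
    obtain ⟨m, hm, hlt, hbit⟩ := ih (by omega) (by omega)
    refine ⟨(m ||| (χ (v + 1)).toNat <<< (v + 1)) &&& frontierMask d (v + 2), ?_,
      Nat.and_lt_two_pow _ (Nat.ofBits_lt_two_pow _), ?_⟩
    · obtain ⟨h1, h2, h3, h4⟩ := cutCode_div (m := m)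
        (c := ∑ w ∈ Finset.range (v + 1), cutAt d χ w)
        (a := min 3 (Nat.count (fun w => χ w = true) (v + 1)))
        (b := min 3 (Nat.count (fun w => χ w = false) (v + 1)))
        (by omega) (by omega) (by omega)
      have hcount : (earlier d (v + 1)).countP (fun w => m.testBit w != χ (v + 1)) =
          cutAt d χ (v + 1) := by
        refine List.countP_congr fun w hw => ?_
        simp only [earlier, List.mem_filter, List.mem_map, List.mem_finRange, true_and,
          decide_eq_true_eq] at hw
        obtain ⟨⟨i, rfl⟩, hlt⟩ := hw
        rw [hbit _ hlt (nbrRev d (v + 1) i) (nbr_nbrRev (by omega) i).ge]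
      have key : ∀ u, (extendCode (earlier d (v + 1)) (frontierMask d (v + 2)) (v + 1)
          (cutCode m (∑ w ∈ Finset.range (v + 1), cutAt d χ w)
            (min 3 (Nat.count (fun w => χ w = true) (v + 1)))
            (min 3 (Nat.count (fun w => χ w = false) (v + 1)))) (χ (v + 1)) u).Mem
          (cutCode ((m ||| (χ (v + 1)).toNat <<< (v + 1)) &&& frontierMask d (v + 2))
            (∑ w ∈ Finset.range (v + 2), cutAt d χ w)
            (min 3 (Nat.count (fun w => χ w = true) (v + 2)))
            (min 3 (Nat.count (fun w => χ w = false) (v + 2)))) := by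
        intro u
        unfold extendCode
        dsimp only
        rw [h1, h2, h3, h4, hcount, Nat.ble_eq_true_of_le hc, cond_true]
        apply SearchTree.mem_insert
        left
        rw [Finset.sum_range_succ, Nat.count_succ _ (v + 1), Nat.count_succ _ (v + 1)]
        congr 1 <;> cases χ (v + 1) <;> simp <;> omega
      refine SearchTree.mem_insertAll (fun y u hu => mem_extendCode_of_mem
        (mem_extendCode_of_mem hu)) (fun u => ?_) _ hm _
      rcases hx : χ (v + 1) with _ | _
      · rw [hx] at key
        exact mem_extendCode_of_mem (key _)
      · rw [hx] at key
        exact key _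
    · intro w hw i hi
      rw [Nat.testBit_and, testBit_frontierMask hw hi, Bool.and_true, Nat.testBit_or,
        Nat.testBit_shiftLeft]
      by_cases hwv : w = v + 1
      · subst hwv
        rw [Nat.testBit_lt_two_pow hlt]
        cases χ (v + 1) <;> simp
      · rw [hbit w (by omega) i (by omega)]
        have : ¬ w ≥ v + 1 := by omega
        simp [this]

/-- A set of at least three vertices with at least three vertices outside is left by at least five
edges. -/
def CutBound (d : ℕ) : Prop :=
  ∀ (χ : ℕ → Bool) (A B : Finset ℕ), 3 ≤ A.card → 3 ≤ B.card →
    (∀ v ∈ A, v < 66 + 4 * d ∧ χ v = true) → (∀ v ∈ B, v < 66 + 4 * d ∧ χ v = false) →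
    5 ≤ ∑ v ∈ Finset.range (66 + 4 * d), cutAt d χ v

theorem cutAt_not (d : ℕ) (χ : ℕ → Bool) (v : ℕ) : cutAt d (fun w => !χ w) v = cutAt d χ v := by
  simp [cutAt]

theorem cutBound_of_cutClasses {d : ℕ} (h : ((cutClasses d (65 + 4 * d)).all fun s =>
    Nat.blt (s / 4 % 4) 3 || Nat.blt (s % 4) 3) = true) : CutBound d := by
  obtain ⟨N, hN⟩ : ∃ N, N = 65 + 4 * d := ⟨_, rfl⟩
  rw [← hN] at h
  have hN' : 66 + 4 * d = N + 1 := by omega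
  have key : ∀ (χ : ℕ → Bool) (A B : Finset ℕ), χ 0 = false → 3 ≤ A.card → 3 ≤ B.card →
      (∀ v ∈ A, v < N + 1 ∧ χ v = true) → (∀ v ∈ B, v < N + 1 ∧ χ v = false) →
      5 ≤ ∑ v ∈ Finset.range (N + 1), cutAt d χ v := by
    intro χ A B h0 hA hB hA' hB'
    by_contra! hc
    obtain ⟨m, hm, -, -⟩ := exists_mem_cutClasses (d := d) (v := N) χ h0 (by omega) (by omega)
    have := SearchTree.of_all h hm
    obtain ⟨-, -, h3, h4⟩ := cutCode_div (m := m)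
      (c := ∑ w ∈ Finset.range (N + 1), cutAt d χ w)
      (a := min 3 (Nat.count (fun w => χ w = true) (N + 1)))
      (b := min 3 (Nat.count (fun w => χ w = false) (N + 1)))
      (by omega) (by omega) (by omega)
    have h1 : 3 ≤ Nat.count (fun w => χ w = true) (N + 1) := by
      rw [Nat.count_eq_card_filter_range]
      exact hA.trans (Finset.card_le_card fun v hv => by simpa using hA' v hv)
    have h2 : 3 ≤ Nat.count (fun w => χ w = false) (N + 1) := by
      rw [Nat.count_eq_card_filter_range]
      exact hB.trans (Finset.card_le_card fun v hv => by simpa using hB' v hv)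
    rw [h3, h4, Bool.or_eq_true, Nat.blt_eq, Nat.blt_eq] at this
    omega
  intro χ A B hA hB hA' hB'
  rw [hN'] at hA' hB' ⊢
  rcases h0 : χ 0 with _ | _
  · exact key χ A B h0 hA hB hA' hB'
  · have := key (fun w => !χ w) B A (by simp [h0]) hB hA (by simpa using hB') (by simpa using hA')
    simpa only [cutAt_not] using this

theorem cutBound_zero : CutBound 0 :=
  cutBound_of_cutClasses (by decide +kernel)

theorem earlier_low {d v : ℕ} (hv : v < 50) : earlier d v = earlier 0 v := by
  have : ∀ w, w < v → ∀ i, nbr d v i = w ↔ nbr 0 v i = w := by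
    intro w hw i
    rcases nbr_low hv i with ⟨h, h'⟩ | ⟨r, h'⟩ | ⟨r, h'⟩
    · rw [h', h']
    · rw [h', h']
    · rw [h', h']
      omega
  have h1 : ∀ i, nbr d v i < v ↔ nbr 0 v i < v := fun i =>
    ⟨fun h => by rwa [(this _ h i).1 rfl], fun h => by rwa [(this _ h i).2 rfl]⟩
  simp only [earlier, List.filter_map]
  have h2 : ((fun x => decide (x < v)) ∘ nbr d v) = ((fun x => decide (x < v)) ∘ nbr 0 v) := by
    funext i
    simp [h1]
  rw [h2]
  refine List.map_congr_left fun i hi => ?_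
  simp only [List.mem_filter, Function.comp_apply, decide_eq_true_eq] at hi
  exact (this _ hi.2 i).2 rfl

theorem earlier_eq (d v : ℕ) :
    earlier d v = [nbr d v 0, nbr d v 1, nbr d v 2].filter (· < v) := rfl

theorem earlier_center {d j : ℕ} (h : j < d + 4) :
    earlier d (50 + 4 * j + 3) = [50 + 4 * j, 50 + 4 * j + 1, 50 + 4 * j + 2] := by
  rw [earlier_eq, nbr_chain_center h, nbr_chain_center h, nbr_chain_center h]
  simp

theorem earlier_leaf_zero {d : ℕ} (r : Fin 3) :
    earlier d (50 + 4 * 0 + r) = [![20, 48, 49] r] := by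
  have hr : (![20, 48, 49] : Fin 3 → ℕ) r < 50 := by
    revert r
    decide
  rw [earlier_eq, nbr_chain_leaf_one (by omega), nbr_chain_leaf_two (by omega), Nat.mul_zero,
    Nat.add_zero, nbr_first]
  generalize (![20, 48, 49] : Fin 3 → ℕ) r = x at *
  have h1 : x < 50 + (r : ℕ) := by omega
  have h2 : ¬ 53 < 50 + (r : ℕ) := by omega
  simp [h1, h2]

theorem earlier_leaf_succ {d j : ℕ} (h : j + 1 < d + 3) (r : Fin 3) :
    earlier d (50 + 4 * (j + 1) + r) = [50 + 4 * j + r] := by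
  rw [earlier_eq, nbr_chain_leaf_one (by omega), nbr_chain_leaf_two (by omega),
    nbr_chain_leaf_zero (by omega)]
  simp

theorem earlier_leaf_last {d : ℕ} (r : Fin 3) :
    earlier d (50 + 4 * (d + 2 + 1) + r) = [50 + 4 * (d + 2) + r, ![21, 49, 46] r] := by
  have hr : (![21, 49, 46] : Fin 3 → ℕ) r < 50 := by
    revert r
    decide
  rw [earlier_eq, nbr_last, nbr_chain_leaf_two (by omega), nbr_chain_leaf_zero (by omega)]
  generalize (![21, 49, 46] : Fin 3 → ℕ) r = x at *
  simp [List.filter_cons]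
  omega

/-- The number of edges cut that join a vertex of the claw `j` to an earlier vertex. -/
def clawCut (d : ℕ) (χ : ℕ → Bool) (j : ℕ) : ℕ :=
  ∑ r : Fin 3, cutAt d χ (50 + 4 * j + r) + cutAt d χ (50 + 4 * j + 3)

/-- The number of pairs `x r`, `y r` separated by `χ`. -/
def mismatch (χ : ℕ → Bool) (x y : Fin 3 → ℕ) : ℕ := ∑ r, (χ (x r) != χ (y r)).toNat

theorem mismatch_congr {χ ψ : ℕ → Bool} {x y x' y' : Fin 3 → ℕ} (hx : ∀ r, χ (x r) = ψ (x' r))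
    (hy : ∀ r, χ (y r) = ψ (y' r)) : mismatch χ x y = mismatch ψ x' y' := by
  simp only [mismatch, hx, hy]

theorem mismatch_le (χ : ℕ → Bool) (x y z : Fin 3 → ℕ) :
    mismatch χ x z ≤ mismatch χ x y + mismatch χ y z := by
  have h : ∀ a b c : Bool, (a != c).toNat ≤ (a != b).toNat + (b != c).toNat := by decide
  rw [mismatch, mismatch, mismatch, ← Finset.sum_add_distrib]
  exact Finset.sum_le_sum fun r _ => h _ _ _

theorem cutAt_leaf {d j : ℕ} (χ : ℕ → Bool) (h : j < d + 4) (r : Fin 3) :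
    cutAt d χ (50 + 4 * j + r) =
      (if j = 0 then (χ (![20, 48, 49] r) != χ (50 + 4 * j + r)).toNat
        else (χ (50 + 4 * (j - 1) + r) != χ (50 + 4 * j + r)).toNat) +
      (if j = d + 3 then (χ (![21, 49, 46] r) != χ (50 + 4 * j + r)).toNat else 0) := by
  have hcount : ∀ (w x : ℕ), (if (χ w != χ x) = true then 1 else 0) = (χ w != χ x).toNat := by
    intro w x
    cases χ w != χ x <;> rfl
  rcases j with _ | j
  · rw [cutAt, earlier_leaf_zero, if_pos rfl, if_neg (by omega), List.countP_singleton, hcount]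
    rfl
  · rw [if_neg (Nat.succ_ne_zero j), Nat.add_sub_cancel]
    by_cases hj : j + 1 < d + 3
    · rw [cutAt, earlier_leaf_succ hj, if_neg (c := j + 1 = d + 3) (by omega),
        List.countP_singleton, hcount]
      rfl
    · obtain rfl : j = d + 2 := by omega
      rw [cutAt, earlier_leaf_last, if_pos rfl, List.countP_cons, List.countP_singleton, hcount,
        hcount, Nat.add_comm]

theorem clawCut_eq {d j : ℕ} (χ : ℕ → Bool) (h : j < d + 4) :
    clawCut d χ j = mismatch χ (fun r => 50 + 4 * j + r) (fun _ => 50 + 4 * j + 3) +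
      (if j = 0 then mismatch χ ![20, 48, 49] (fun r => 50 + 4 * j + r)
        else mismatch χ (fun r => 50 + 4 * (j - 1) + r) (fun r => 50 + 4 * j + r)) +
      (if j = d + 3 then mismatch χ ![21, 49, 46] (fun r => 50 + 4 * j + r) else 0) := by
  have h3 : cutAt d χ (50 + 4 * j + 3) =
      mismatch χ (fun r => 50 + 4 * j + r) (fun _ => 50 + 4 * j + 3) := by
    have hcount : ∀ (w x : ℕ), (if (χ w != χ x) = true then 1 else 0) = (χ w != χ x).toNat := by
      intro w x
      cases χ w != χ x <;> rfl
    rw [cutAt, earlier_center h, List.countP_cons, List.countP_cons, List.countP_singleton, hcount,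
      hcount, hcount, mismatch, Fin.sum_univ_three]
    simp only [Fin.val_zero, Fin.val_one, Fin.val_two, Nat.add_zero]
    omega
  rw [clawCut, h3, Finset.sum_congr rfl fun r _ => cutAt_leaf χ h r, Finset.sum_add_distrib]
  split_ifs <;> simp only [mismatch, Finset.sum_const_zero] <;> omega

theorem sum_range_add_four_mul (f : ℕ → ℕ) (a m : ℕ) :
    ∑ v ∈ Finset.range (a + 4 * m), f v = ∑ v ∈ Finset.range a, f v +
      ∑ j ∈ Finset.range m, (∑ r : Fin 3, f (a + 4 * j + r) + f (a + 4 * j + 3)) := by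
  induction m with
  | zero => simp
  | succ m ih =>
    rw [show a + 4 * (m + 1) = a + 4 * m + 1 + 1 + 1 + 1 by omega, Finset.sum_range_succ,
      Finset.sum_range_succ, Finset.sum_range_succ, Finset.sum_range_succ, ih,
      Finset.sum_range_succ _ m, Fin.sum_univ_three]
    simp only [Fin.val_zero, Fin.val_one, Fin.val_two, Nat.add_zero, Nat.add_assoc]

theorem sum_range_le_of_skip {f g : ℕ → ℕ} {p m : ℕ} (hp : p < m) (h1 : ∀ j < p, f j ≤ g j)
    (h2 : f p ≤ g p + g (p + 1)) (h3 : ∀ j, p < j → j < m → f j ≤ g (j + 1)) :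
    ∑ j ∈ Finset.range m, f j ≤ ∑ j ∈ Finset.range (m + 1), g j := by
  induction m, hp using Nat.le_induction with
  | base =>
    have := Finset.sum_le_sum fun j hj => h1 j (Finset.mem_range.1 hj)
    rw [Finset.sum_range_succ, Finset.sum_range_succ, Finset.sum_range_succ]
    omega
  | succ m hm ih =>
    have := ih fun j hj hj' => h3 j hj (by omega)
    have := h3 m (by omega) (by omega)
    rw [Finset.sum_range_succ, Finset.sum_range_succ _ (m + 1)]
    omega

theorem sum_cutAt (d : ℕ) (χ : ℕ → Bool) :
    ∑ v ∈ Finset.range (66 + 4 * d), cutAt d χ v =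
      ∑ v ∈ Finset.range 50, cutAt 0 χ v + ∑ j ∈ Finset.range (d + 4), clawCut d χ j := by
  rw [show 66 + 4 * d = 50 + 4 * (d + 4) by omega, sum_range_add_four_mul]
  have : ∑ v ∈ Finset.range 50, cutAt d χ v = ∑ v ∈ Finset.range 50, cutAt 0 χ v :=
    Finset.sum_congr rfl fun v hv => by
      rw [cutAt, cutAt, earlier_low (Finset.mem_range.1 hv)]
  rw [this]
  simp only [clawCut]

/-- The relabelling of the vertices when the claw `p` of the chain is inserted. -/
def expand (p v : ℕ) : ℕ := if v < 50 + 4 * p then v else v + 4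

theorem sum_cutAt_expand_le {d p : ℕ} (χ : ℕ → Bool) (hp : p < d + 4) :
    ∑ v ∈ Finset.range (66 + 4 * d), cutAt d (fun v => χ (expand p v)) v ≤
      ∑ v ∈ Finset.range (66 + 4 * (d + 1)), cutAt (d + 1) χ v := by
  obtain ⟨ψ, hψ⟩ : ∃ ψ, ψ = fun v => χ (expand p v) := ⟨_, rfl⟩
  rw [← hψ]
  have hlow : ∀ v < 50, ψ v = χ v := by
    intro v hv
    rw [hψ]
    dsimp only
    rw [expand, if_pos (by omega)]
  have hlt : ∀ j, j < p → ∀ r : Fin 3, ψ (50 + 4 * j + r) = χ (50 + 4 * j + r) := by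
    intro j hj r
    rw [hψ]
    dsimp only
    rw [expand, if_pos (by omega)]
  have hlt' : ∀ j, j < p → ψ (50 + 4 * j + 3) = χ (50 + 4 * j + 3) := by
    intro j hj
    rw [hψ]
    dsimp only
    rw [expand, if_pos (by omega)]
  have hge : ∀ j, p ≤ j → ∀ t, ψ (50 + 4 * j + t) = χ (50 + 4 * (j + 1) + t) := by
    intro j hj t
    rw [hψ]
    dsimp only
    rw [expand, if_neg (by omega)]
    congr 1
    omega
  have hfirst : ∀ r, ψ (![20, 48, 49] r) = χ (![20, 48, 49] r) := by
    intro r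
    have : ∀ r, (![20, 48, 49] : Fin 3 → ℕ) r < 50 := by decide
    exact hlow _ (this r)
  have hlast : ∀ r, ψ (![21, 49, 46] r) = χ (![21, 49, 46] r) := by
    intro r
    have : ∀ r, (![21, 49, 46] : Fin 3 → ℕ) r < 50 := by decide
    exact hlow _ (this r)
  rw [sum_cutAt, sum_cutAt]
  refine Nat.add_le_add (Finset.sum_le_sum fun v hv => ?_) ?_
  · rw [Finset.mem_range] at hv
    refine (List.countP_congr fun w hw => ?_).le
    have : w < v := by
      simp only [earlier, List.mem_filter, decide_eq_true_eq] at hw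
      exact hw.2
    rw [hlow v hv, hlow w (by omega)]
  · refine sum_range_le_of_skip hp (fun j hj => ?_) ?_ (fun j hj hj' => ?_)
    · rw [clawCut_eq _ (by omega), clawCut_eq _ (by omega), if_neg (c := j = d + 3) (by omega),
        mismatch_congr (hlt j hj) (fun _ => hlt' j hj), mismatch_congr hfirst (hlt j hj)]
      by_cases h0 : j = 0
      · rw [if_pos h0, if_pos h0]
        omega
      · rw [if_neg h0, if_neg h0, mismatch_congr (hlt (j - 1) (by omega)) (hlt j hj)]
        omega
    · rw [clawCut_eq _ hp, clawCut_eq _ (by omega), clawCut_eq _ (by omega),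
        mismatch_congr (fun r => hge p le_rfl r) (fun _ => hge p le_rfl 3),
        mismatch_congr hfirst (fun r => hge p le_rfl r),
        mismatch_congr hlast (fun r => hge p le_rfl r), if_neg (Nat.succ_ne_zero p),
        Nat.add_sub_cancel]
      have : ∀ x y z : ℕ, (if p = d + 3 then x else 0) = if p + 1 = d + 1 + 3 then x else 0 := by
        simp
      rw [this _ 0 0]
      by_cases h0 : p = 0
      · rw [if_pos h0, if_pos h0]
        have := mismatch_le χ ![20, 48, 49] (fun r => 50 + 4 * p + r)
          (fun r => 50 + 4 * (p + 1) + r)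
        omega
      · rw [if_neg h0, if_neg h0,
          mismatch_congr (hlt (p - 1) (by omega)) (fun r => hge p le_rfl r)]
        have := mismatch_le χ (fun r => 50 + 4 * (p - 1) + r) (fun r => 50 + 4 * p + r)
          (fun r => 50 + 4 * (p + 1) + r)
        omega
    · rw [clawCut_eq _ hj', clawCut_eq _ (by omega),
        mismatch_congr (fun r => hge j hj.le r) (fun _ => hge j hj.le 3),
        mismatch_congr hlast (fun r => hge j hj.le r), if_neg (by omega),
        if_neg (Nat.succ_ne_zero j), Nat.add_sub_cancel,
        mismatch_congr (fun r => hge (j - 1) (by omega) r) (fun r => hge j hj.le r),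
        Nat.sub_add_cancel (by omega)]
      have : ∀ x : ℕ, (if j = d + 3 then x else 0) = if j + 1 = d + 1 + 3 then x else 0 := by
        simp
      rw [this]

theorem cutBound_succ {d : ℕ} (h : CutBound d) : CutBound (d + 1) := by
  have avoid : ∀ s : Finset ℕ, s.card ≤ 3 → ∃ p < d + 4, ∀ v ∈ s, v < 50 + 4 * p ∨
      54 + 4 * p ≤ v := by
    intro s hs
    obtain ⟨k, hk, hk'⟩ : ∃ k ∈ Finset.range (d + 4), k ∉ s.image fun v => (v - 50) / 4 := by
      apply Finset.exists_mem_notMem_of_card_lt_card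
      have := Finset.card_image_le (s := s) (f := fun v => (v - 50) / 4)
      rw [Finset.card_range]
      omega
    refine ⟨k, Finset.mem_range.1 hk, fun v hv => ?_⟩
    by_contra hc
    exact hk' (Finset.mem_image.2 ⟨v, hv, by omega⟩)
  have key : ∀ (χ : ℕ → Bool) (A B : Finset ℕ), 3 ≤ A.card → B.card = 3 →
      (∀ v ∈ A, v < 50 ∧ χ v = true) → (∀ v ∈ B, v < 66 + 4 * (d + 1) ∧ χ v = false) →
      5 ≤ ∑ v ∈ Finset.range (66 + 4 * (d + 1)), cutAt (d + 1) χ v := by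
    intro χ A B hA hB hA' hB'
    obtain ⟨p, hp, hp'⟩ := avoid B hB.le
    have hexp : ∀ v ∈ B, expand p (if v < 50 + 4 * p then v else v - 4) = v := by
      intro v hv
      have := hp' v hv
      unfold expand
      split_ifs <;> omega
    refine (h (fun v => χ (expand p v)) A (B.image fun v => if v < 50 + 4 * p then v else v - 4)
      hA ?_ ?_ ?_).trans (sum_cutAt_expand_le χ hp)
    · rw [Finset.card_image_of_injOn, hB]
      intro v hv w hw hvw
      rw [← hexp v hv, ← hexp w hw]
      exact congrArg (expand p) hvw
    · intro v hv
      have := hA' v hv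
      refine ⟨by omega, ?_⟩
      rw [expand, if_pos (by omega)]
      exact this.2
    · intro w hw
      obtain ⟨v, hv, rfl⟩ := Finset.mem_image.1 hw
      refine ⟨?_, by rw [hexp v hv]; exact (hB' v hv).2⟩
      have := hp' v hv
      have := (hB' v hv).1
      split_ifs <;> omega
  intro χ A B hA hB hA' hB'
  obtain ⟨A₀, hA₀, hA₀'⟩ := Finset.exists_subset_card_eq hA
  obtain ⟨B₀, hB₀, hB₀'⟩ := Finset.exists_subset_card_eq hB
  have hsplit := Finset.card_filter_add_card_filter_not (s := Finset.range 50)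
    (fun v => χ v = true)
  rw [Finset.card_range] at hsplit
  by_cases hc : 3 ≤ ((Finset.range 50).filter fun v => χ v = true).card
  · exact key χ _ B₀ hc hB₀' (fun v hv => by simpa using hv) fun v hv => hB' v (hB₀ hv)
  · have := key (fun v => !χ v) ((Finset.range 50).filter fun v => ¬ χ v = true) A₀ (by omega) hA₀'
      (fun v hv => by simpa using hv) (fun v hv => by simpa using hA' v (hA₀ hv))
    simpa only [cutAt_not] using this

theorem cutBound (d : ℕ) : CutBound d := by
  induction d with
  | zero => exact cutBound_zero
  | succ d ih => exact cutBound_succ ih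

theorem cutAt_eq_sum (d : ℕ) (χ : ℕ → Bool) (v : ℕ) :
    cutAt d χ v = ∑ i, if nbr d v i < v ∧ χ (nbr d v i) ≠ χ v then 1 else 0 := by
  rw [cutAt, earlier_eq, List.countP_filter, List.countP_cons, List.countP_cons, List.countP_cons,
    List.countP_nil, Fin.sum_univ_three]
  simp [and_comm]
  omega

theorem five_le_ncard {d : ℕ} {F : Set (Sym2 (Fin (66 + 4 * d)))} {S : Set (Fin (66 + 4 * d))}
    (hS : ∀ v w, (chainGraph d).Adj v w → s(v, w) ∉ F → v ∈ S → w ∈ S)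
    {A B : Finset (Fin (66 + 4 * d))} (hA : 3 ≤ A.card) (hB : 3 ≤ B.card) (hAS : ∀ v ∈ A, v ∈ S)
    (hBS : ∀ v ∈ B, v ∉ S) : 5 ≤ F.ncard := by
  classical
  let χ : ℕ → Bool := fun v => decide (∃ h : v < 66 + 4 * d, (⟨v, h⟩ : Fin _) ∈ S)
  have hχ : ∀ v : Fin (66 + 4 * d), χ v = decide (v ∈ S) := by
    intro v
    simp [χ]
  have h5 := cutBound d χ (A.map Fin.valEmbedding) (B.map Fin.valEmbedding) (by simpa) (by simpa)
    (by
      intro v hv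
      obtain ⟨w, hw, rfl⟩ := Finset.mem_map.1 hv
      refine ⟨w.isLt, ?_⟩
      rw [Fin.valEmbedding_apply, hχ]
      simpa using hAS w hw)
    (by
      intro v hv
      obtain ⟨w, hw, rfl⟩ := Finset.mem_map.1 hv
      refine ⟨w.isLt, ?_⟩
      rw [Fin.valEmbedding_apply, hχ]
      simpa using hBS w hw)
  refine h5.trans ?_
  rw [Finset.sum_range]
  simp only [cutAt_eq_sum]
  rw [← Fintype.sum_prod_type' (f := fun (v : Fin (66 + 4 * d)) (i : Fin 3) =>
    if nbr d v i < v ∧ χ (nbr d v i) ≠ χ v then 1 else 0), ← Finset.card_filter,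
    Set.ncard_eq_toFinset_card']
  refine Finset.card_le_card_of_injOn (fun x => s(x.1, nb x.1 x.2)) ?_ ?_
  · rintro ⟨v, i⟩ hx
    simp only [Finset.coe_filter, Finset.mem_univ, true_and, Set.mem_ofPred_eq] at hx
    have hadj : (chainGraph d).Adj v (nb v i) := ⟨i, rfl⟩
    rw [Set.coe_toFinset]
    by_contra hF
    refine hx.2 ?_
    rw [show nbr d v i = (nb v i : ℕ) from rfl, hχ, hχ, decide_eq_decide]
    exact ⟨hS _ _ hadj.symm (by rwa [Sym2.eq_swap]), hS _ _ hadj hF⟩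
  · rintro ⟨v, i⟩ hx ⟨w, k⟩ hy h
    simp only [Finset.coe_filter, Finset.mem_univ, true_and, Set.mem_ofPred_eq] at hx hy
    rcases Sym2.eq_iff.1 h with ⟨rfl, h2⟩ | ⟨h1, h2⟩
    · exact congrArg (Prod.mk v) (nb_injective v h2)
    · have h1' := congrArg Fin.val h1
      have h2' := congrArg Fin.val h2
      simp only [nb] at h1' h2'
      omega

theorem connected_chainGraph (d : ℕ) : (chainGraph d).Connected := by
  have : Nonempty (Fin (66 + 4 * d)) := ⟨⟨0, by omega⟩⟩
  refine ⟨fun a b => ?_⟩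
  by_contra hab
  have hcard : ∀ a : Fin (66 + 4 * d), 3 ≤ (Finset.univ.image (nb a)).card := fun a => by
    rw [Finset.card_image_of_injective _ (nb_injective a), Finset.card_univ, Fintype.card_fin]
  have hreach : ∀ a, ∀ v ∈ Finset.univ.image (nb a), (chainGraph d).Reachable a v := by
    intro a v hv
    obtain ⟨i, -, rfl⟩ := Finset.mem_image.1 hv
    exact SimpleGraph.Adj.reachable ⟨i, rfl⟩
  have := five_le_ncard (F := ∅) (S := {v | (chainGraph d).Reachable a v})
    (fun v w hvw _ hv => hv.trans hvw.reachable) (hcard a) (hcard b) (hreach a)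
    (fun v hv h => hab (h.trans (hreach b v hv).symm))
  simp at this

theorem cyclicallyConnected_chainGraph (d : ℕ) : CyclicallyConnected (chainGraph d) 5 := by
  rintro ⟨F, -, hF, a, b, ⟨p, hp⟩, ⟨q, hq⟩, hab⟩
  have hcard : ∀ (a : Fin (66 + 4 * d)) (p : ((chainGraph d).deleteEdges F).Walk a a),
      p.IsCycle → 3 ≤ p.support.tail.toFinset.card := by
    intro a p hp
    rw [List.toFinset_card_of_nodup hp.support_nodup, List.length_tail,
      SimpleGraph.Walk.length_support]
    exact hp.three_le_length
  have hreach : ∀ (a : Fin (66 + 4 * d)) (p : ((chainGraph d).deleteEdges F).Walk a a),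
      ∀ v ∈ p.support.tail.toFinset, ((chainGraph d).deleteEdges F).Reachable a v := by
    intro a p v hv
    exact ⟨p.takeUntil v (List.mem_of_mem_tail (List.mem_toFinset.1 hv))⟩
  have := five_le_ncard (F := F) (S := {v | ((chainGraph d).deleteEdges F).Reachable a v})
    (fun v w hvw hF hv => hv.trans
      (SimpleGraph.Adj.reachable (SimpleGraph.deleteEdges_adj.2 ⟨hvw, hF⟩)))
    (hcard a p hp) (hcard b q hq) (hreach a p) (fun v hv h => hab (h.trans (hreach b q v hv).symm))
  omega

/-! ### Edge colourings as colourings of half-edges -/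

noncomputable def kolEquiv : Fin 3 ≃ Kol := Fintype.equivOfCardEq (by decide)

theorem threeEdgeColorable_of_halfEdges {d : ℕ} {Y : Set (Fin (66 + 4 * d))}
    (c : ℕ → Fin 3 → Fin 3)
    (hc : ∀ v < 66 + 4 * d, ∀ i, c (nbr d v i) (nbrRev d v i) = c v i)
    (hinj : ∀ v : Fin (66 + 4 * d), v ∉ Y → Function.Injective (c v)) :
    ThreeEdgeColorable ((chainGraph d).induce Yᶜ) := by
  classical
  have hwd : ∀ (v w : Fin (66 + 4 * d)) i k, s(v, nb v i) = s(w, nb w k) → c v i = c w k := by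
    intro v w i k h
    rcases Sym2.eq_iff.1 h with ⟨rfl, h2⟩ | ⟨h1, h2⟩
    · rw [nb_injective v h2]
    · have h3 : nbrRev d v i = k := by
        refine nb_injective w (Fin.ext ?_)
        rw [← h1, ← nbr_nbrRev v.isLt i, ← h2]
        simp only [nb, nbr_nbrRev v.isLt i]
      rw [← hc v v.isLt i, h3, ← h2]
      rfl
  have hex : ∀ e : Sym2 (Yᶜ : Set (Fin (66 + 4 * d))), ∃ x : Fin 3, ∀ v i,
      e.map Subtype.val = s(v, nb v i) → c v i = x := by
    intro e
    by_cases h : ∃ v i, e.map Subtype.val = s(v, nb v i)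
    · obtain ⟨v, i, hvi⟩ := h
      exact ⟨c v i, fun w k h => hwd w v k i (h.symm.trans hvi)⟩
    · exact ⟨0, fun v i hvi => (h ⟨v, i, hvi⟩).elim⟩
  choose f hf using hex
  refine ⟨fun e => kolEquiv (f e), ?_⟩
  rintro e₁ h₁ e₂ h₂ hne ⟨v, hv₁, hv₂⟩ heq
  have hedge : ∀ e ∈ ((chainGraph d).induce Yᶜ).edgeSet, v ∈ e →
      ∃ i, e.map Subtype.val = s(v.1, nb v.1 i) := by
    intro e he hve
    obtain ⟨w, rfl⟩ := hve
    obtain ⟨i, hi⟩ := chainGraph_adj_iff.1 (SimpleGraph.comap_adj.1 he)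
    exact ⟨i, congrArg (fun x => s(v.1, x)) hi.symm⟩
  obtain ⟨i, hi⟩ := hedge e₁ h₁ hv₁
  obtain ⟨k, hk⟩ := hedge e₂ h₂ hv₂
  have := kolEquiv.injective heq
  rw [← hf _ _ _ hi, ← hf _ _ _ hk] at this
  have hik := hinj v.1 v.2 this
  subst hik
  exact hne (Sym2.map.injective Subtype.val_injective (hi.trans hk.symm))

theorem exists_injective_extension (g : Fin 3 → Fin 3) (k : Fin 3)
    (h : ∀ i j, i ≠ k → j ≠ k → g i = g j → i = j) :
    ∃ c : Fin 3 → Fin 3, Function.Injective c ∧ ∀ i, i ≠ k → c i = g i := by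
  revert g k
  decide +kernel

theorem ThreeEdgeColorable.induce {V : Type*} {G : SimpleGraph V} (h : ThreeEdgeColorable G)
    (s : Set V) : ThreeEdgeColorable (G.induce s) := by
  obtain ⟨f, hf⟩ := h
  refine ⟨fun e => f (e.map Subtype.val), ?_⟩
  have hmap : ∀ e ∈ (G.induce s).edgeSet, e.map Subtype.val ∈ G.edgeSet := by
    intro e
    induction e with
    | _ v w => exact fun h => h
  rintro e₁ h₁ e₂ h₂ hne ⟨v, hv₁, hv₂⟩
  exact hf _ (hmap _ h₁) _ (hmap _ h₂) (fun h => hne (Sym2.map.injective Subtype.val_injective h))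
    ⟨v, Sym2.mem_map.2 ⟨v, hv₁, rfl⟩, Sym2.mem_map.2 ⟨v, hv₂, rfl⟩⟩

/-- If every vertex outside `Y` has at most one neighbour in `Y`, a colouring of the graph without
`Y` extends to the half-edges leading to `Y`. -/
theorem exists_halfEdges {d : ℕ} {Y : Set (Fin (66 + 4 * d))}
    (hY : ∀ v ∉ Y, ∃ k, ∀ i, nb v i ∈ Y → i = k)
    (h : ThreeEdgeColorable ((chainGraph d).induce Yᶜ)) :
    ∃ c : Fin (66 + 4 * d) → Fin 3 → Fin 3, (∀ v ∉ Y, Function.Injective (c v)) ∧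
      ∀ v w i k, v ∉ Y → w ∉ Y → nb v i = w → nb w k = v → c v i = c w k := by
  classical
  obtain ⟨f, hf⟩ := h
  let g : Fin (66 + 4 * d) → Fin (66 + 4 * d) → Fin 3 := fun v w =>
    if h : v ∉ Y ∧ w ∉ Y then kolEquiv.symm (f s(⟨v, h.1⟩, ⟨w, h.2⟩)) else 0
  have hg : ∀ v ∉ Y, ∃ c : Fin 3 → Fin 3, Function.Injective c ∧
      ∀ i, nb v i ∉ Y → c i = g v (nb v i) := by
    intro v hv
    obtain ⟨k, hk⟩ := hY v hv
    obtain ⟨c, hc, hc'⟩ := exists_injective_extension (fun i => g v (nb v i)) k (by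
      intro i j hi hj hij
      have hi' : nb v i ∉ Y := fun h => hi (hk i h)
      have hj' : nb v j ∉ Y := fun h => hj (hk j h)
      by_contra hne
      simp only [g, hv, hi', hj', not_false_eq_true, and_self, dite_true] at hij
      refine hf s(⟨v, hv⟩, ⟨nb v i, hi'⟩) ?_ s(⟨v, hv⟩, ⟨nb v j, hj'⟩) ?_ ?_
        ⟨⟨v, hv⟩, Sym2.mem_mk_left _ _, Sym2.mem_mk_left _ _⟩ (kolEquiv.symm.injective hij)
      · exact ⟨i, rfl⟩
      · exact ⟨j, rfl⟩
      · intro h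
        rcases Sym2.eq_iff.1 h with ⟨-, h⟩ | ⟨h1, h2⟩
        · exact hne (nb_injective v (congrArg Subtype.val h))
        · exact hne (nb_injective v ((congrArg Subtype.val h2).trans (congrArg Subtype.val h1)))
      )
    by_cases h : ∃ i, nb v i ∈ Y
    · obtain ⟨i, hi⟩ := h
      have := hk i hi
      subst this
      exact ⟨c, hc, fun j hj => hc' j fun h => hj (h ▸ hi)⟩
    · push Not at h
      refine ⟨fun i => g v (nb v i), fun i j hij => ?_, fun i _ => rfl⟩
      by_contra hne
      have hi' := h i
      have hj' := h j
      simp only [g, hv, hi', hj', not_false_eq_true, and_self, dite_true] at hij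
      refine hf s(⟨v, hv⟩, ⟨nb v i, hi'⟩) ⟨i, rfl⟩ s(⟨v, hv⟩, ⟨nb v j, hj'⟩) ⟨j, rfl⟩ ?_
        ⟨⟨v, hv⟩, Sym2.mem_mk_left _ _, Sym2.mem_mk_left _ _⟩ (kolEquiv.symm.injective hij)
      intro h
      rcases Sym2.eq_iff.1 h with ⟨-, h⟩ | ⟨h1, h2⟩
      · exact hne (nb_injective v (congrArg Subtype.val h))
      · exact hne (nb_injective v ((congrArg Subtype.val h2).trans (congrArg Subtype.val h1)))
  choose! c hc hc' using hg
  refine ⟨c, hc, fun v w i k hv hw hvw hwv => ?_⟩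
  rw [hc' v hv i (by rwa [hvw]), hc' w hw k (by rwa [hwv]), hvw, hwv]
  simp only [g, hv, hw, not_false_eq_true, and_self, dite_true]
  rw [Sym2.eq_swap]

/-! ### Colourings of a chain of claws -/

/-- The edges entering and leaving a claw through its leaves can be coloured `L` and `R` in a proper
colouring of the claw. -/
def ClawStep (L R : Fin 3 → Fin 3) : Prop :=
  (∀ i, L i ≠ R i) ∧ Function.Injective fun i => -(L i + R i)

instance : DecidableRel ClawStep := fun _ _ => inferInstanceAs (Decidable (_ ∧ _))

theorem clawStep_reduce : ∀ L M, ClawStep L M → ∀ N, ClawStep M N → ∀ P, ClawStep N P →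
    ∀ R, ClawStep P R → ∃ M, ClawStep L M ∧ ClawStep M R := by
  decide +kernel

theorem clawStep_even (s : ℕ → Fin 3 → Fin 3) (k : ℕ)
    (h : ∀ j < 2 * k + 2, ClawStep (s j) (s (j + 1))) :
    ∃ M, ClawStep (s 0) M ∧ ClawStep M (s (2 * k + 2)) := by
  induction k with
  | zero => exact ⟨s 1, h 0 (by omega), h 1 (by omega)⟩
  | succ k ih =>
    obtain ⟨M, h1, h2⟩ := ih fun j hj => h j (by omega)
    exact clawStep_reduce _ _ h1 _ h2 _ (h _ (by omega)) _ (h _ (by omega))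

theorem Function.Injective.eq_neg_add : ∀ {f : Fin 3 → Fin 3}, Function.Injective f →
    ∀ i, f i = -(f (i + 1) + f (i + 2)) := by
  decide +kernel

theorem clawStep_of_injective {a : Fin 3 → Fin 3 → Fin 3} (ha : ∀ r, Function.Injective (a r))
    (h : Function.Injective fun r => a r 2) : ClawStep (fun r => a r 0) fun r => a r 1 := by
  refine ⟨fun r => (ha r).ne (by decide), ?_⟩
  have h2 : ∀ r, a r 2 = -(a r 0 + a r 1) := fun r => (ha r).eq_neg_add 2
  simpa only [h2] using h

theorem exists_clawStep_chain (c : ℕ → Fin 3 → Fin 3) (p k : ℕ)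
    (hleaf : ∀ j < 2 * k + 2, ∀ r : Fin 3, Function.Injective (c (p + 4 * j + r)))
    (hcenter : ∀ j < 2 * k + 2, Function.Injective (c (p + 4 * j + 3)))
    (hspoke : ∀ j < 2 * k + 2, ∀ r : Fin 3, c (p + 4 * j + r) 2 = c (p + 4 * j + 3) r)
    (hlink : ∀ j, j + 1 < 2 * k + 2 → ∀ r : Fin 3,
      c (p + 4 * j + r) 1 = c (p + 4 * (j + 1) + r) 0) :
    ∃ M, ClawStep (fun r => c (p + r) 0) M ∧
      ClawStep M fun r => c (p + 4 * (2 * k + 1) + r) 1 := by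
  have := clawStep_even (fun j r => if j = 0 then c (p + r) 0 else c (p + 4 * (j - 1) + r) 1) k
    fun j hj => by
      have h := clawStep_of_injective (a := fun r => c (p + 4 * j + r)) (hleaf j hj)
        (by simpa only [hspoke j hj] using hcenter j hj)
      rcases j with _ | j
      · simpa using h
      · simpa [hlink j hj] using h
  simpa using this

/-! ### The graph without the vertices 19 and 20 is not colourable -/

/-- In a piece, the dangling edges at `b` and at the last leaf of the third row have distinct
colours. -/
theorem piece_ne : ∀ L M, ClawStep L M → ∀ R, ClawStep M R → ∀ x y, x ≠ y → x ≠ L 1 → y ≠ L 2 →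
    y ≠ R 1 → L 2 ≠ R 1 → ∀ z, z ≠ x → z ≠ L 1 → z ≠ R 2 := by
  decide +kernel

/-- In a coloured hexagon, some two opposite pendant edges have the same colour. -/
theorem hexagon : ∀ e₀ e₁ : Fin 3, e₀ ≠ e₁ → ∀ e₂, e₁ ≠ e₂ → ∀ e₃, e₂ ≠ e₃ → ∀ e₄, e₃ ≠ e₄ →
    ∀ e₅, e₄ ≠ e₅ → e₅ ≠ e₀ → e₅ + e₀ = e₂ + e₃ ∨ e₀ + e₁ = e₃ + e₄ ∨ e₁ + e₂ = e₄ + e₅ := by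
  decide +kernel

theorem nbr_low_first (d : ℕ) (r : Fin 3) :
    nbr d (![20, 48, 49] r) (![2, 2, 1] r) = 50 + r := by
  have h : ∀ r : Fin 3, ![20, 48, 49] r < 54 ∧
      baseNbr.getD (![20, 48, 49] r) 0 (![2, 2, 1] r) = 50 + r := by
    decide
  rw [nbr_of_lt (h r).1, (h r).2, if_pos (by omega)]

theorem nbr_low_last (d : ℕ) (r : Fin 3) :
    nbr d (![21, 49, 46] r) 2 = 50 + 4 * (d + 3) + r := by
  have h : ∀ r : Fin 3, ![21, 49, 46] r < 54 ∧ baseNbr.getD (![21, 49, 46] r) 0 2 = 62 + r := by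
    decide
  rw [nbr_of_lt (h r).1, (h r).2, if_neg (by omega)]
  omega

/-- The removed vertices. -/
def tops (d : ℕ) : Set (Fin (66 + 4 * d)) := {v | (v : ℕ) = 19 ∨ (v : ℕ) = 20}

theorem exists_nb_mem_tops {d : ℕ} (v : Fin (66 + 4 * d)) :
    ∃ k, ∀ i, nb v i ∈ tops d → i = k := by
  have key : ∀ w < 66 + 4 * d, ∀ i, nbr d v i = w →
      ∃ k, (v : ℕ) = nbr d w k ∧ i = nbrRev d w k := by
    rintro _ h i rfl
    refine ⟨nbrRev d v i, (nbr_nbrRev v.isLt i).symm, nbr_injective v.isLt ?_⟩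
    have := nbr_nbrRev h (nbrRev d v i)
    rw [nbr_nbrRev v.isLt] at this
    exact this.symm
  have h19 : ∀ k, nbrRev d 19 k = if nbr d 19 k = 0 then 2 else 0 := by
    intro k
    fin_cases k <;> rfl
  have h20 : ∀ k, nbrRev d 20 k = if nbr d 20 k = 0 then 2 else 0 := by
    intro k
    fin_cases k <;> rfl
  refine ⟨if (v : ℕ) = 0 then 2 else 0, fun i hi => ?_⟩
  rcases hi with hi | hi
  · obtain ⟨k, hk, hk'⟩ := key 19 (by omega) i hi
    rw [hk, hk', h19]
  · obtain ⟨k, hk, hk'⟩ := key 20 (by omega) i hi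
    rw [hk, hk', h20]

/-- The half-edges of the graph without the vertices 19 and 20 have no consistent colouring. -/
theorem not_exists_halfEdges {k : ℕ} (c : ℕ → Fin 3 → Fin 3)
    (hinj : ∀ v < 66 + 4 * (2 * k), v ≠ 19 ∧ v ≠ 20 → Function.Injective (c v))
    (hc : ∀ v w i j, v < 66 + 4 * (2 * k) → w < 66 + 4 * (2 * k) → v ≠ 19 ∧ v ≠ 20 →
      w ≠ 19 ∧ w ≠ 20 → nbr (2 * k) v i = w → nbr (2 * k) w j = v → c v i = c w j) : False := by
  have hinj_low : ∀ v, (v < 50 ∧ v ≠ 19 ∧ v ≠ 20) → Function.Injective (c v) :=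
    fun v h => hinj v (by omega) h.2
  have low : ∀ v i w j, (v < 50 ∧ w < 50 ∧ (v ≠ 19 ∧ v ≠ 20) ∧ (w ≠ 19 ∧ w ≠ 20) ∧
      baseNbr.getD v 0 i = w ∧ baseNbr.getD w 0 j = v) → c v i = c w j := by
    intro v i w j ⟨hv, hw, hv', hw', h1, h2⟩
    apply hc v w i j (by omega) (by omega) hv' hw'
    · rw [nbr_of_lt (by omega), h1, if_pos (by omega)]
    · rw [nbr_of_lt (by omega), h2, if_pos (by omega)]
  have chain_low : ∀ p, p = 3 ∨ p = 27 → ∃ M, ClawStep (fun r => c (p + r) 0) M ∧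
      ClawStep M fun r => c (p + 12 + r) 1 := by
    intro p hp
    have hN : ∀ j < 4, ∀ r : Fin 3, p + 4 * j + r < 50 ∧ p + 4 * j + 3 < 50 ∧
        (p + 4 * j + r ≠ 19 ∧ p + 4 * j + r ≠ 20) ∧ (p + 4 * j + 3 ≠ 19 ∧ p + 4 * j + 3 ≠ 20) := by
      omega
    refine exists_clawStep_chain c p 1 (fun j hj r => ?_) (fun j hj => ?_) (fun j hj r => ?_)
      (fun j hj r => ?_)
    · exact hinj_low _ ⟨(hN j hj r).1, (hN j hj r).2.2.1⟩
    · exact hinj_low _ ⟨(hN j hj 0).2.1, (hN j hj 0).2.2.2⟩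
    · have : ∀ p, p = 3 ∨ p = 27 → ∀ j < 4, ∀ r : Fin 3,
          baseNbr.getD (p + 4 * j + r) 0 2 = p + 4 * j + 3 ∧
          baseNbr.getD (p + 4 * j + 3) 0 r = p + 4 * j + r := by
        rintro _ (rfl | rfl) <;> decide +kernel
      obtain ⟨h1, h2, h3, h4⟩ := hN j hj r
      exact low _ _ _ _ ⟨h1, h2, h3, h4, this p hp j hj r⟩
    · have : ∀ p, p = 3 ∨ p = 27 → ∀ j < 3, ∀ r : Fin 3,
          baseNbr.getD (p + 4 * j + r) 0 1 = p + 4 * (j + 1) + r ∧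
          baseNbr.getD (p + 4 * (j + 1) + r) 0 0 = p + 4 * j + r := by
        rintro _ (rfl | rfl) <;> decide +kernel
      obtain ⟨h1, h2, h3, h4⟩ := hN j (by omega) r
      obtain ⟨h1', -, h3', -⟩ := hN (j + 1) (by omega) r
      exact low _ _ _ _ ⟨h1, h1', h3, h3', this p hp j (by omega) r⟩
  have chain_high : ∃ M, ClawStep (fun r => c (50 + r) 0) M ∧
      ClawStep M fun r => c (50 + 4 * (2 * k + 3) + r) 1 := by
    refine exists_clawStep_chain c 50 (k + 1) (fun j hj r => ?_) (fun j hj => ?_)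
      (fun j hj r => ?_) (fun j hj r => ?_)
    · exact hinj _ (by omega) (by omega)
    · exact hinj _ (by omega) (by omega)
    · exact hc _ _ _ _ (by omega) (by omega) (by omega) (by omega)
        (nbr_chain_leaf_two (by omega) r) (nbr_chain_center (by omega) r)
    · exact hc _ _ _ _ (by omega) (by omega) (by omega) (by omega)
        (nbr_chain_leaf_one (by omega) r) (nbr_chain_leaf_zero (by omega) r)
  have first : ∀ r, r ≠ 0 → c (![20, 48, 49] r) (![2, 2, 1] r) = c (50 + r) 0 := by
    intro r hr
    have h : ∀ r : Fin 3, r ≠ 0 → ![20, 48, 49] r < 50 ∧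
        (![20, 48, 49] r ≠ 19 ∧ ![20, 48, 49] r ≠ 20) := by
      decide
    exact hc _ _ _ _ (by have := h r hr; omega) (by omega) (h r hr).2 (by omega)
      (nbr_low_first _ r) (nbr_first _ r)
  have last : ∀ r, c (![21, 49, 46] r) 2 = c (50 + 4 * (2 * k + 3) + r) 1 := by
    intro r
    have h : ∀ r : Fin 3, ![21, 49, 46] r < 50 ∧
        (![21, 49, 46] r ≠ 19 ∧ ![21, 49, 46] r ≠ 20) := by
      decide
    exact hc _ _ _ _ (by have := h r; omega) (by omega) (h r).2 (by omega) (nbr_low_last _ r)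
      (nbr_last _ r)
  have ne : ∀ v, (v < 50 ∧ v ≠ 19 ∧ v ≠ 20) → ∀ i j, i ≠ j → c v i ≠ c v j :=
    fun v h i j hij => (hinj_low v h).ne hij
  obtain ⟨M, h₁, h₂⟩ := chain_low 3 (.inl rfl)
  obtain ⟨M', h₁', h₂'⟩ := chain_low 27 (.inr rfl)
  obtain ⟨M'', h₁'', h₂''⟩ := chain_high
  have p₂ := piece_ne _ _ h₁ _ h₂ (c 1 0) (c 2 0)
    (fun h => ne 0 (by decide) 0 1 (by decide)
      ((low 0 0 1 0 (by decide)).trans (h.trans (low 2 0 0 1 (by decide)))))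
    (fun h => ne 1 (by decide) 0 1 (by decide) (h.trans (low 4 0 1 1 (by decide))))
    (fun h => ne 2 (by decide) 0 1 (by decide) (h.trans (low 5 0 2 1 (by decide))))
    (fun h => ne 2 (by decide) 0 2 (by decide) (h.trans (low 16 1 2 2 (by decide))))
    (fun h => ne 2 (by decide) 1 2 (by decide)
      ((low 5 0 2 1 (by decide)).symm.trans (h.trans (low 16 1 2 2 (by decide)))))
    (c 1 2) (ne 1 (by decide) _ _ (by decide))
    (fun h => ne 1 (by decide) 2 1 (by decide) (h.trans (low 4 0 1 1 (by decide))))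
  have p₁ := piece_ne _ _ h₁' _ h₂' (c 25 0) (c 26 0)
    (fun h => ne 24 (by decide) 1 2 (by decide)
      ((low 24 1 25 0 (by decide)).trans (h.trans (low 26 0 24 2 (by decide)))))
    (fun h => ne 25 (by decide) 0 1 (by decide) (h.trans (low 28 0 25 1 (by decide))))
    (fun h => ne 26 (by decide) 0 1 (by decide) (h.trans (low 29 0 26 1 (by decide))))
    (fun h => ne 26 (by decide) 0 2 (by decide) (h.trans (low 40 1 26 2 (by decide))))
    (fun h => ne 26 (by decide) 1 2 (by decide)
      ((low 29 0 26 1 (by decide)).symm.trans (h.trans (low 40 1 26 2 (by decide)))))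
    (c 25 2) (ne 25 (by decide) _ _ (by decide))
    (fun h => ne 25 (by decide) 2 1 (by decide) (h.trans (low 28 0 25 1 (by decide))))
  have p₀ := piece_ne _ _ h₁'' _ h₂'' (c 48 1) (c 49 0)
    (fun h => ne 47 (by decide) 1 2 (by decide)
      ((low 47 1 48 1 (by decide)).trans (h.trans (low 49 0 47 2 (by decide)))))
    (fun h => ne 48 (by decide) 1 2 (by decide) (h.trans (first 1 (by decide)).symm))
    (fun h => ne 49 (by decide) 0 1 (by decide) (h.trans (first 2 (by decide)).symm))
    (fun h => ne 49 (by decide) 0 2 (by decide) (h.trans (last 1).symm))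
    (fun h => ne 49 (by decide) 1 2 (by decide)
      ((first 2 (by decide)).trans (h.trans (last 1).symm)))
    (c 48 0) (ne 48 (by decide) _ _ (by decide))
    (fun h => ne 48 (by decide) 0 2 (by decide) (h.trans (first 1 (by decide)).symm))
  have hex := hexagon (c 45 1) (c 43 0)
    (fun h => ne 43 (by decide) 2 0 (by decide) ((low 43 2 45 1 (by decide)).trans h)) (c 22 2)
    (fun h => ne 22 (by decide) 1 2 (by decide) ((low 22 1 43 0 (by decide)).trans h)) (c 46 1)
    (fun h => ne 46 (by decide) 0 1 (by decide) ((low 46 0 22 2 (by decide)).trans h)) (c 44 0)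
    (fun h => ne 44 (by decide) 2 0 (by decide) ((low 44 2 46 1 (by decide)).trans h)) (c 23 2)
    (fun h => ne 23 (by decide) 1 2 (by decide) ((low 23 1 44 0 (by decide)).trans h))
    (fun h => ne 45 (by decide) 0 1 (by decide) ((low 45 0 23 2 (by decide)).trans h))
  have pendant : ∀ v w i, (v < 50 ∧ v ≠ 19 ∧ v ≠ 20) → (w < 50 ∧ w ≠ 19 ∧ w ≠ 20) →
      c v (i + 1) + c v (i + 2) = c w (i + 1) + c w (i + 2) → c v i = c w i := by
    intro v w i hv hw h
    rw [(hinj_low v hv).eq_neg_add, (hinj_low w hw).eq_neg_add, h]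
  rcases hex with h | h | h
  · rw [low 23 2 45 0 (by decide), low 22 2 46 0 (by decide)] at h
    exact p₀ (((low 48 0 45 2 (by decide)).trans
      (pendant 45 46 2 (by decide) (by decide) h)).trans (last 2))
  · rw [low 45 1 43 2 (by decide), low 46 1 44 2 (by decide)] at h
    exact p₁ (((low 25 2 43 1 (by decide)).trans
      (pendant 43 44 1 (by decide) (by decide) h)).trans (low 44 1 41 1 (by decide)))
  · rw [low 43 0 22 1 (by decide), low 44 0 23 1 (by decide)] at h
    exact p₂ (((low 1 2 22 0 (by decide)).trans
      (pendant 22 23 0 (by decide) (by decide) h)).trans (low 23 0 17 1 (by decide)))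

theorem not_threeEdgeColorable_induce (k : ℕ) :
    ¬ ThreeEdgeColorable ((chainGraph (2 * k)).induce (tops (2 * k))ᶜ) := by
  intro h
  obtain ⟨c, hinj, hc⟩ := exists_halfEdges (fun v _ => exists_nb_mem_tops v) h
  have hmem : ∀ v (hv : v < 66 + 4 * (2 * k)), v ≠ 19 ∧ v ≠ 20 → ⟨v, hv⟩ ∉ tops (2 * k) :=
    fun v hv h h' => h'.elim h.1 h.2
  refine not_exists_halfEdges (k := k) (fun v => if h : v < 66 + 4 * (2 * k) then c ⟨v, h⟩ else 0)
    (fun v hv h => ?_) (fun v w i j hv hw hv' hw' h1 h2 => ?_)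
  · simpa only [hv, dite_true] using hinj _ (hmem v hv h)
  · simpa only [hv, hw, dite_true] using
      hc ⟨v, hv⟩ ⟨w, hw⟩ i j (hmem v hv hv') (hmem w hw hw') (Fin.ext h1) (Fin.ext h2)

theorem isSnark_chainGraph (k : ℕ) : IsSnark (chainGraph (2 * k)) :=
  ⟨connected_chainGraph _, isCubic_chainGraph _,
    fun h => not_threeEdgeColorable_induce k (h.induce _)⟩

theorem not_bicritical_chainGraph (k : ℕ) : ¬ Bicritical (chainGraph (2 * k)) := by
  intro h
  refine not_threeEdgeColorable_induce k ?_
  have : tops (2 * k) = {⟨19, by omega⟩, ⟨20, by omega⟩} := by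
    ext v
    simp [tops, Fin.ext_iff]
  rw [this]
  exact h _ _ (by simp)

/-! ### Colourings with a relaxed section of the chain -/

/-- As `ClawStep`, but the colouring need not be proper at the leaf `μ.1`, and not at the centre if
`μ.2` holds. -/
def RelaxedStep (μ : Option (Fin 3) × Bool) (L R : Fin 3 → Fin 3) : Prop :=
  (∀ r, μ.1 ≠ some r → L r ≠ R r) ∧
    (μ.2 = false → ∀ r t, μ.1 ≠ some r → μ.1 ≠ some t → L r + R r = L t + R t → r = t)

instance (μ : Option (Fin 3) × Bool) : DecidableRel (RelaxedStep μ) :=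
  fun _ _ => inferInstanceAs (Decidable (_ ∧ _))

theorem RelaxedStep.symm {μ : Option (Fin 3) × Bool} {L R : Fin 3 → Fin 3}
    (h : RelaxedStep μ L R) : RelaxedStep μ R L :=
  ⟨fun r hr => (h.1 r hr).symm, by simpa only [add_comm] using h.2⟩

theorem RelaxedStep.exists_spokes {μ : Option (Fin 3) × Bool} {L R : Fin 3 → Fin 3}
    (h : RelaxedStep μ L R) : ∃ p : Fin 3 → Fin 3,
      (∀ r, μ.1 ≠ some r → Function.Injective ![L r, R r, p r]) ∧
      (μ.2 = false → Function.Injective p) := by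
  have hinj : ∀ x y : Fin 3, x ≠ y → Function.Injective ![x, y, -(x + y)] := by decide +kernel
  obtain ⟨μ, _ | _⟩ := μ
  · obtain ⟨p, hp, hp'⟩ : ∃ p : Fin 3 → Fin 3, Function.Injective p ∧
        ∀ r, μ ≠ some r → p r = -(L r + R r) := by
      have h2 := fun r t hr ht => h.2 rfl r t hr ht
      cases μ with
      | none => exact ⟨_, fun r t hrt => h2 r t (by simp) (by simp) (neg_injective hrt),
          fun _ _ => rfl⟩
      | some k =>
        obtain ⟨p, hp, hp'⟩ := exists_injective_extension (fun r => -(L r + R r)) k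
          fun r t hr ht hrt => h2 r t (by simpa using hr.symm) (by simpa using ht.symm)
            (neg_injective hrt)
        exact ⟨p, hp, fun r hr => hp' r (by simpa [eq_comm] using hr)⟩
    exact ⟨p, fun r hr => by rw [hp' r hr]; exact hinj _ _ (h.1 r hr), fun _ => hp⟩
  · exact ⟨fun r => -(L r + R r), fun r hr => hinj _ _ (h.1 r hr), fun h => by cases h⟩

/-- The colours of the links of a chain in which the claws from `a` to `a + w` are relaxed. -/
def IsRelaxedPath (μ : Option (Fin 3) × Bool) (a w b : ℕ) (s : ℕ → Fin 3 → Fin 3) : Prop :=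
  ∀ j < a + w + b, RelaxedStep (if a ≤ j ∧ j < a + w then μ else (none, false)) (s j) (s (j + 1))

instance (μ : Option (Fin 3) × Bool) (a w b : ℕ) (s : ℕ → Fin 3 → Fin 3) :
    Decidable (IsRelaxedPath μ a w b s) :=
  inferInstanceAs (Decidable (∀ j < a + w + b, _))

/-- A path lengthened by repeating the unrelaxed step `q` twice. -/
theorem IsRelaxedPath.pad {μ : Option (Fin 3) × Bool} {a w b q : ℕ} {s : ℕ → Fin 3 → Fin 3}
    (h : IsRelaxedPath μ a w b s) (a' b' : ℕ)
    (hq : q < a ∧ a' = a + 2 ∧ b' = b ∨ a + w ≤ q ∧ q < a + w + b ∧ a' = a ∧ b' = b + 2) :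
    IsRelaxedPath μ a' w b' fun j => if j ≤ q + 1 then s j else s (j - 2) := by
  have hq' := h q (by omega)
  rw [if_neg (by omega)] at hq'
  intro j hj
  rcases lt_trichotomy j (q + 1) with hjq | rfl | hjq
  · have := h j (by omega)
    simp only [show j ≤ q + 1 by omega, show j + 1 ≤ q + 1 by omega, if_true]
    convert this using 2
    omega
  · rw [if_neg (by omega)]
    simpa using hq'.symm
  · have := h (j - 2) (by omega)
    simp only [show ¬ j ≤ q + 1 by omega, show ¬ j + 1 ≤ q + 1 by omega, if_false,
      show j + 1 - 2 = j - 2 + 1 by omega]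
    convert this using 2
    omega

theorem IsRelaxedPath.exists_pad {μ : Option (Fin 3) × Bool} {a w b : ℕ} {s : ℕ → Fin 3 → Fin 3}
    (h : IsRelaxedPath μ a w b s) (k l : ℕ) (hk : 0 < a ∨ k = 0) (hl : 0 < b ∨ l = 0) :
    ∃ s', IsRelaxedPath μ (a + 2 * k) w (b + 2 * l) s' ∧ s' 0 = s 0 ∧
      s' (a + 2 * k + w + (b + 2 * l)) = s (a + w + b) := by
  induction k with
  | zero =>
    induction l with
    | zero => exact ⟨s, h, rfl, rfl⟩
    | succ l ih =>
      obtain ⟨s', h1, h2, h3⟩ := ih (by omega)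
      refine ⟨_, h1.pad (q := a + w) _ _ (.inr ⟨by omega, by omega, rfl, rfl⟩), by simpa using h2,
        ?_⟩
      rw [if_neg (by omega), ← h3]
      rfl
  | succ k ih =>
    obtain ⟨s', h1, h2, h3⟩ := ih (by omega)
    refine ⟨_, h1.pad (q := 0) _ _ (.inl ⟨by omega, rfl, rfl⟩), by simpa using h2, ?_⟩
    rw [if_neg (by omega), ← h3]
    congr 1
    omega

theorem nbrRev_eq {d v w : ℕ} {i k : Fin 3} (hv : v < 66 + 4 * d) (h1 : nbr d v i = w)
    (h2 : nbr d w k = v) : nbrRev d v i = k := by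
  subst h1
  exact nbr_injective (nbr_lt hv i) ((nbr_nbrRev hv i).trans h2.symm)

/-- The colours of the half-edges at `v`, given the colours `B` at the fixed part, the colours `s`
of the links and the colours `p` of the edges at the centres. -/
def chainColors (B s p : ℕ → Fin 3 → Fin 3) (v : ℕ) : Fin 3 → Fin 3 :=
  if v < 50 then B v
  else if (v - 50) % 4 = 3 then p ((v - 50) / 4)
  else ![s ((v - 50) / 4) (Fin.ofNat 3 ((v - 50) % 4)),
    s ((v - 50) / 4 + 1) (Fin.ofNat 3 ((v - 50) % 4)),
    p ((v - 50) / 4) (Fin.ofNat 3 ((v - 50) % 4))]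

section chainColors

variable {B s p : ℕ → Fin 3 → Fin 3}

theorem chainColors_low {v : ℕ} (hv : v < 50) : chainColors B s p v = B v :=
  if_pos hv

theorem chainColors_center (j : ℕ) : chainColors B s p (50 + 4 * j + 3) = p j := by
  rw [chainColors, if_neg (by omega), if_pos (by omega)]
  congr 1
  omega

theorem chainColors_leaf (j : ℕ) (r : Fin 3) :
    chainColors B s p (50 + 4 * j + r) = ![s j r, s (j + 1) r, p j r] := by
  have h1 : (50 + 4 * j + (r : ℕ) - 50) / 4 = j := by omega
  have h2 : (50 + 4 * j + (r : ℕ) - 50) % 4 = r := by omega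
  have h3 : Fin.ofNat 3 (r : ℕ) = r := by simp
  rw [chainColors, if_neg (by omega), h1, h2, h3, if_neg (by omega)]

theorem chainColors_nbr {d : ℕ}
    (hB : ∀ v < 50, ∀ i, baseNbr.getD v 0 i < 50 →
      B (baseNbr.getD v 0 i) (baseRev.getD v 0 i) = B v i)
    (hfirst : ∀ r, B (![20, 48, 49] r) (![2, 2, 1] r) = s 0 r)
    (hlast : ∀ r, B (![21, 49, 46] r) 2 = s (d + 4) r) :
    ∀ v < 66 + 4 * d, ∀ i,
      chainColors B s p (nbr d v i) (nbrRev d v i) = chainColors B s p v i := by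
  have link : ∀ v w i k, v < 66 + 4 * d → nbr d v i = w → nbr d w k = v →
      chainColors B s p w k = chainColors B s p v i →
      chainColors B s p (nbr d v i) (nbrRev d v i) = chainColors B s p v i := by
    intro v w i k hv h1 h2 h
    rwa [nbrRev_eq hv h1 h2, h1]
  have hleaf : ∀ j < d + 4, ∀ r i : Fin 3,
      chainColors B s p (nbr d (50 + 4 * j + r) i) (nbrRev d (50 + 4 * j + r) i) =
        chainColors B s p (50 + 4 * j + r) i := by
    intro j hj r i
    obtain rfl | rfl | rfl : i = 0 ∨ i = 1 ∨ i = 2 := by omega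
    · rcases j with _ | j
      · have h : ∀ r : Fin 3, ![20, 48, 49] r < 50 := by decide
        refine link _ _ _ _ (by omega) (nbr_first d r) (nbr_low_first d r) ?_
        have := chainColors_leaf (B := B) (s := s) (p := p) 0 r
        rw [chainColors_low (h r), hfirst]
        simp at this ⊢
        simp [this]
      · refine link _ _ _ _ (by omega) (nbr_chain_leaf_zero hj r) (nbr_chain_leaf_one hj r) ?_
        rw [chainColors_leaf, chainColors_leaf]
        rfl
    · by_cases hj' : j + 1 < d + 4
      · refine link _ _ _ _ (by omega) (nbr_chain_leaf_one hj' r) (nbr_chain_leaf_zero hj' r) ?_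
        rw [chainColors_leaf, chainColors_leaf]
        rfl
      · obtain rfl : j = d + 3 := by omega
        have h : ∀ r : Fin 3, ![21, 49, 46] r < 50 := by decide
        refine link _ _ _ _ (by omega) (nbr_last d r) (nbr_low_last d r) ?_
        rw [chainColors_low (h r), hlast, chainColors_leaf]
        rfl
    · refine link _ _ _ _ (by omega) (nbr_chain_leaf_two hj r) (nbr_chain_center hj r) ?_
      rw [chainColors_leaf, chainColors_center]
      rfl
  have symm : ∀ v i w, v < 66 + 4 * d → nbr d v i = w → (∀ k,
      chainColors B s p (nbr d w k) (nbrRev d w k) = chainColors B s p w k) →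
      chainColors B s p (nbr d v i) (nbrRev d v i) = chainColors B s p v i := by
    rintro v i _ hv rfl h
    have h1 := nbr_nbrRev hv i
    rw [← h, nbrRev_eq (nbr_lt hv i) h1 rfl, h1]
  refine fun v hv => chain_cases (P := fun v => ∀ i,
    chainColors B s p (nbr d v i) (nbrRev d v i) = chainColors B s p v i) ?_ ?_ hleaf hv
  · intro v hv i
    rcases nbr_low hv i with ⟨h, h'⟩ | ⟨r, h⟩ | ⟨r, h⟩
    · rw [h' d, nbrRev_of_lt (by omega), chainColors_low h, chainColors_low hv, hB v hv i h]
    · exact symm v i _ (by omega) (h d) (hleaf 0 (by omega) r)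
    · exact symm v i _ (by omega) (h d) (by simpa using hleaf (d + 3) (by omega) r)
  · intro j hj i
    exact symm _ _ _ (by omega) (nbr_chain_center hj i) (hleaf j hj i)

end chainColors

/-! ### Criticality -/

/-- The `i`-th digit of the block `v` of a list of ternary digits, grouped into blocks of three. -/
def digit (N v : ℕ) (i : Fin 3) : Fin 3 := Fin.ofNat 3 (N / 3 ^ (3 * v + i))

/-- The blocks of `N` are the colours at the vertices of the fixed part, followed by the colours of
the links of the chain, of a colouring which may fail to be proper at `x`, at `y` and in the relaxed
claws. -/
def IsWitness (N x y : ℕ) (μ : Option (Fin 3) × Bool) (a w b : ℕ) : Prop :=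
  (∀ v < 50, ∀ i, baseNbr.getD v 0 i < 50 →
    digit N (baseNbr.getD v 0 i) (baseRev.getD v 0 i) = digit N v i) ∧
  (∀ v < 50, v ≠ x → v ≠ y → Function.Injective (digit N v)) ∧
  (∀ r, digit N (![20, 48, 49] r) (![2, 2, 1] r) = digit N 50 r) ∧
  (∀ r, digit N (![21, 49, 46] r) 2 = digit N (50 + (a + w + b)) r) ∧
  IsRelaxedPath μ a w b fun j => digit N (50 + j)

instance (N x y : ℕ) (μ : Option (Fin 3) × Bool) (a w b : ℕ) :
    Decidable (IsWitness N x y μ a w b) :=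
  inferInstanceAs (Decidable (_ ∧ _ ∧ _ ∧ _ ∧ _))

theorem IsWitness.threeEdgeColorable {N x y a w b d k l : ℕ} {μ : Option (Fin 3) × Bool}
    (h : IsWitness N x y μ a w b) {Y : Set (Fin (66 + 4 * d))}
    (hd : a + 2 * k + w + (b + 2 * l) = d + 4) (hk : 0 < a ∨ k = 0) (hl : 0 < b ∨ l = 0)
    (hx : ∀ v : Fin (66 + 4 * d), (v : ℕ) = x ∨ (v : ℕ) = y → (v : ℕ) < 50 → v ∈ Y)
    (hleaf : ∀ v : Fin (66 + 4 * d), ∀ j r, a + 2 * k ≤ j → j < a + 2 * k + w → μ.1 = some r →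
      (v : ℕ) = 50 + 4 * j + r → v ∈ Y)
    (hcenter : ∀ v : Fin (66 + 4 * d), ∀ j, a + 2 * k ≤ j → j < a + 2 * k + w → μ.2 = true →
      (v : ℕ) = 50 + 4 * j + 3 → v ∈ Y) :
    ThreeEdgeColorable ((chainGraph d).induce Yᶜ) := by
  obtain ⟨hB, hinj, hfirst, hlast, hpath⟩ := h
  obtain ⟨s, hs, hs0, hs1⟩ := hpath.exists_pad k l hk hl
  have hp : ∀ j < d + 4, _ := fun j hj => (hs j (by omega)).exists_spokes
  choose! p hp₁ hp₂ using hp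
  refine threeEdgeColorable_of_halfEdges (chainColors (digit N) s p)
    (chainColors_nbr hB (fun r => ?_) fun r => ?_) fun v hv => ?_
  · rw [hs0]
    exact hfirst r
  · rw [← hd, hs1]
    exact hlast r
  · refine chain_cases (P := fun u => u = (v : ℕ) →
      Function.Injective (chainColors (digit N) s p u)) ?_ ?_ ?_ v.isLt rfl
    · intro u hu huv
      rw [chainColors_low hu]
      exact hinj u hu (fun h => hv (hx v (.inl (by omega)) (by omega)))
        (fun h => hv (hx v (.inr (by omega)) (by omega)))
    · intro j hj huv
      rw [chainColors_center]
      refine hp₂ j hj ?_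
      split_ifs with hjw
      · by_contra h
        exact hv (hcenter v j hjw.1 hjw.2 (by simpa using h) huv.symm)
      · rfl
    · intro j hj r huv
      rw [chainColors_leaf]
      refine hp₁ j hj r ?_
      split_ifs with hjw
      · exact fun h => hv (hleaf v j r hjw.1 hjw.2 h huv.symm)
      · simp

/-- Witnesses for the edges of the fixed part. -/
def edgeWitnesses : List (ℕ × ℕ × ℕ) :=
  [(0, 1, 1097554400613494340475254589613620005136819888457062869474905449451265741817869),
   (0, 2, 1097554399561100259375825096858856016442591187364657632491366851340987729018957),
   (0, 19, 1093912921386611436205383674271803540579840588371918990728886197260248663802301),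
   (1, 4, 4534308624314990963431720667313024912695262015293522542862074893573294997523901),
   (1, 22, 1097554400613494424711002855457314554425912685893628887121609606996074184301589),
   (2, 5, 1093912921386611438835807417695173691904145543392779613996393278432519833663995),
   (2, 16, 1093912921386611436205383674271803558127999262625202807845894685941205638509419),
   (3, 20, 962608077920980259911109538288303387769306010491456400704688207221796941794072),
   (3, 7, 1093912921386611438835802461557882981192955592926608766749201419396666999182663),
   (3, 6, 1093912921386611438835802461557882981192955592926608401258239323944289022451575),
   (4, 8, 1093912921386611438835807417695173691904145543392779497240139645690491551391647),
   (4, 6, 1093912921386611438835807417695173691904145543392779862731101741142578191221751),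
   (5, 9, 1093912921386611436205383674271803558127999262625202208765601765612538136551957),
   (5, 6, 1093912921386611436205383674271803558127999262625202574257031600399209970519845),
   (7, 11, 1093912921386611436205383674271803558127999262625202574256563840963952633746605),
   (7, 10, 1093912921386611436205383674271803558127999262625202208765821755419262103277173),
   (8, 12, 1093912921386611438835807417695173691904145543392779862731789324651901407478039),
   (8, 10, 1093912921386611438835807417695173691904145543392779497241955102097769781267447),
   (9, 13, 1093912921386611438835807417695173691904145543392779497241263317844489189926039),
   (9, 10, 1093912921386611438835807417695173691904145543392779862731101740530267384847423),
   (11, 15, 1093912921386611436205383674271803558127999262625202325359148485733994733463569),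
   (11, 14, 1093912921386611438835807417695173691904145543392779497242284554468292733386943),
   (12, 16, 1093912921386611438835807417695173691904145543392779614235692455445927522945239),
   (12, 14, 1093912921386611436205383674271803558127999262625202208767306240251718096994797),
   (13, 17, 1093912921386611438835807417695173691904145543392780347288604889624403351070039),
   (13, 14, 1093912921386611436205383674271803558127999262625202574255753438941107981084325),
   (15, 21, 933438185760810843762233360109889694054267299306925297394968355836270321151198),
   (15, 18, 1093912921386611430601890905781881627840622090676499692242118281358585187599827),
   (16, 18, 1093912921386611438835807417695173691904145543392779804638184724024073213572087),
   (17, 23, 1093912921386613329840912097367457945941073110545183073106873150006406411381527),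
   (17, 18, 1093912921386611438835807417695173691904145543392779441221597943295464114294463),
   (19, 24, 4025374186100630472736433655705520828440461718627892649450652711753130760141280),
   (19, 47, 1531322302688292829765544022437419242450773249753513566658067582444672155998923),
   (20, 27, 4022215958377214667733116089275986219338552294299262615879227188802217603008068),
   (21, 39, 4211276065335472921955036948495182747463507369484443289536510142236610770600889),
   (22, 43, 1097554400612097938337526284256012800417548767348781351996364735691433220836553),
   (22, 46, 2888207285091258167920068654855726182588807175524356799531699431077037544483844),
   (23, 44, 2888207285093407212023791377364731978168748273349448651743847276706879200285024),
   (23, 45, 1097554400613520492809104235464706787075809254756947324453983891009976518789441),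
   (24, 25, 3850331496608881251621091535113224575849594756895679023586099477452699432388743),
   (24, 26, 3850331496608881251617513014813583772096838911593394588950220286294192531989933),
   (25, 28, 3850331496608881251621096491164230150962343770098356210855389420576858777310723),
   (25, 43, 1097554400613496065488469956339681684498155864560194368795119413578986506038713),
   (26, 29, 3850331496608881268088929515049121871434882171471639909600600127579610256203679),
   (26, 40, 3850331496608881251619294538338852402894096106670298752822746802779143555384497),
   (27, 31, 3850331496608881251617513014804257597582799775150821928762189480297108164129359),
   (27, 30, 3850331496608881270719199697183515681559557603796608815559124152056400654898847),
   (28, 32, 3850331496608881268092523528827878402521219615879104887428734796838664577764563),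
   (28, 30, 3850331496608881270726397637075081402766785809889287112648320096138691879574203),
   (29, 33, 3850331496608881270726397637133560707127984354016107952125137077356083754822867),
   (29, 30, 3850331496608881268092523528886179658437011721342856866882230777306783521208035),
   (31, 35, 3850331496608881268092512991024057095187710569299440284581166206576171619814963),
   (31, 34, 3850331496608881270726397637042509175310726730345832240219821302619350842306171),
   (32, 36, 3850331496608881270726387714693595717767753053310952312330590334015684382807771),
   (32, 34, 3850331496608881268092503079139250048459260420038175605316208839610453002986875),
   (33, 37, 3850331496608881270726371957465090007545662393742043616252750009871403885271187),
   (33, 34, 3850331496608881268092503079139415424045236177533546308493622520472232759876291),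
   (35, 39, 3850331496608881248990892864861459752995440004225454260447089506836381878245363),
   (35, 38, 3850331496608881268092535906726036975416379735700456011032281218457762764151075),
   (36, 40, 3850331496608881251626498049406170909841708558771588705188590716163650277831451),
   (36, 38, 3850331496608881270726410630386243659349422837586204956596648829025303209873083),
   (37, 41, 3850331496608881262436779126855685543528124302869186078495738160734802842432943),
   (37, 38, 3850331496608881268092494733963494423928247662968694163796053310878901263133483),
   (39, 42, 3850331496608881242425349351930255203560696707595866987998529621734790011543931),
   (40, 42, 3850331496608881242427069900558829913334894765109867995849358228909434811008635),
   (41, 44, 1097554400613599007155966539261433508095433232005748519048925759810236287229497),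
   (41, 42, 3850331496608881247624540459005098197358950953184819286701357220977005441855455),
   (43, 45, 962568119164572044141840892220879305630532991456402361567713380150841587382310),
   (44, 46, 2888207285089851608651295344339497878199607434902715334284493391863155113231570),
   (45, 48, 4594267482815080250287058938159274384257406002627706003428674050474267080330305),
   (47, 48, 555233675861481373011005009487712598590098148081817982037879538230288036645182),
   (47, 49, 555229150622040719330305525333012306127225203756194773120068720780541375451768)]

/-- Witnesses for the edges entering the first claw of the chain. -/
def firstWitnesses : List ℕ :=
  [1462235487110533593967502160873139882986579268490475710241334979329850760602703,
   1093911065860958942812954697655978599110948594245971122068208756334235260590527,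
   510474230517956026305523073680088784255396089651159461909775233453997731775904]

/-- Witnesses for the edges leaving the last claw of the chain. -/
def lastWitnesses : List ℕ :=
  [725309729856700999124237513102164415680950116241092273676088675859031477100770,
   576296291971160220169746116980592972346102213629792348120417984710394650517751,
   1159195169638053146579534291159100301000588766030210723091644601305880377838768]

/-- Witnesses for the edges at the centres of the claws of the chain. -/
def spokeWitnesses : List ℕ :=
  [1123008872467018839179329745568429858925336179041976658833378117420421101934659,
   1665885289020538250024639101543546737465430062524953525179497813154810593589852,
   1647124652898347101735519223668551007425310757496592232069225072699580146876058,
   1721987382983384623183157330588262403016713351683247999145041854899525284082220,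
   1665845330264154456311563233859041954227857923430111435098325773239038004778960,
   1652399208741007871861533758023182394784833118015748122783934341581561869913802,
   1661689619600239910151672994670544497520355457566534066656433621998688768446192,
   1750577873175989024888940658851434809499578874042763452223636414634812578275446,
   1662668609131642856122031752940911686840872865390165273645148599935117194313046,
   1652519085010159253000761361076696744497549535300274393027450461328879636346478,
   1663188072964632174392018032839473868929310673623112444700385118840160848854642,
   1039894659188727915981524961798480724775286861770429289995535092613436375279299]

/-- Witnesses for the edges between consecutive claws of the chain. -/
def linkWitnesses : List ℕ :=
  [1125556243186485688387916310455609790320560046338159901508095662050923638629024,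
   1651590043924236049171747437411960534223997301345195798640200533287166946493239,
   1728730423123149812264710002348444574357011823937850700342823590686149645920245,
   1201546992424947028709763903833566178133854269485536358490821489203357068728848763,
   1662758516333506391976452455231047449125410178353559976327785689745605519137553,
   1665615567414947642461376994673139450611818123634769417131586543723345619116331,
   1714704899632438218975080445087265657969191001648277081851437580249970973297153,
   1212150827627136174451850373336758253496754035014234382286405135631971075180853357,
   1665875299331442301596370134622420541656037027751243002659204803175867446387129,
   1662498784417011732841459315281766358081191274237086390800167430293083691866755,
   985141173253834580639317267105801493492063267063055356269547398026046557154536,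
   1204576505498940732860323888201980824073623567100084260084960867457571662015436635]

theorem isWitness_edge : ∀ e ∈ edgeWitnesses, IsWitness e.2.2 e.1 e.2.1 (none, false) 2 0 2 := by
  decide +kernel

theorem exists_edgeWitness : ∀ v < 50, ∀ i, baseNbr.getD v 0 i < 50 → ∃ e ∈ edgeWitnesses,
    e.1 = v ∧ e.2.1 = baseNbr.getD v 0 i ∨ e.1 = baseNbr.getD v 0 i ∧ e.2.1 = v := by
  decide +kernel

theorem isWitness_first : ∀ r : Fin 3,
    IsWitness (firstWitnesses.getD r 0) (![20, 48, 49] r) 50 (some r, false) 0 1 3 := by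
  decide +kernel

theorem isWitness_last : ∀ r : Fin 3,
    IsWitness (lastWitnesses.getD r 0) (![21, 49, 46] r) 50 (some r, false) 3 1 0 := by
  decide +kernel

theorem isWitness_spoke : ∀ r : Fin 3, ∀ a < 4,
    IsWitness (spokeWitnesses.getD (4 * r + a) 0) 50 50 (some r, true) a 1 (3 - a) := by
  decide +kernel

theorem isWitness_link : ∀ r : Fin 3, ∀ t : Fin 4,
    IsWitness (linkWitnesses.getD (4 * r + t) 0) 50 50 (some r, false) (![0, 1, 2, 2] t) 2
      (![2, 1, 0, 2] t) := by
  decide +kernel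

theorem critical_chainGraph (k : ℕ) : Critical (chainGraph (2 * k)) := by
  let P : ℕ → ℕ → Prop := fun u w => ThreeEdgeColorable
    ((chainGraph (2 * k)).induce {z : Fin (66 + 4 * (2 * k)) | (z : ℕ) = u ∨ (z : ℕ) = w}ᶜ)
  have symm : ∀ {u w}, P u w → P w u := by
    intro u w h
    have hs : {z : Fin (66 + 4 * (2 * k)) | (z : ℕ) = u ∨ (z : ℕ) = w} =
        {z : Fin (66 + 4 * (2 * k)) | (z : ℕ) = w ∨ (z : ℕ) = u} :=
      Set.ext fun _ => or_comm
    dsimp only [P] at h ⊢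
    rwa [← hs]
  have spoke : ∀ j < 2 * k + 4, ∀ r : Fin 3, P (50 + 4 * j + r) (50 + 4 * j + 3) := by
    intro j hj r
    obtain ⟨a, m, l, ha, rfl, hl, hm⟩ : ∃ a m l, a < 4 ∧ j = a + 2 * m ∧
        a + 2 * m + 1 + (3 - a + 2 * l) = 2 * k + 4 ∧ (0 < a ∨ m = 0) ∧ (0 < 3 - a ∨ l = 0) := by
      obtain h | h | h | h : j = 0 ∨ j = 2 * k + 3 ∨ (j % 2 = 1 ∧ j ≠ 2 * k + 3) ∨
          (j % 2 = 0 ∧ j ≠ 0) := by omega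
      · exact ⟨0, 0, k, by omega⟩
      · exact ⟨3, k, 0, by omega⟩
      · exact ⟨1, j / 2, k - j / 2, by omega⟩
      · exact ⟨2, j / 2 - 1, k + 1 - j / 2, by omega⟩
    refine (isWitness_spoke r a ha).threeEdgeColorable (d := 2 * k) hl hm.1 hm.2 ?_ ?_ ?_
    · omega
    · rintro v j r' h1 h2 h3 h4
      obtain rfl : r = r' := Option.some.inj h3
      exact .inl (by omega)
    · rintro v j h1 h2 h3 h4
      exact .inr (by omega)
  have link : ∀ j, j + 1 < 2 * k + 4 → ∀ r : Fin 3,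
      P (50 + 4 * j + r) (50 + 4 * (j + 1) + r) := by
    intro j hj r
    obtain ⟨t, m, l, hj', hl, hm⟩ : ∃ t : Fin 4, ∃ m l, j = ![0, 1, 2, 2] t + 2 * m ∧
        ![0, 1, 2, 2] t + 2 * m + 2 + (![2, 1, 0, 2] t + 2 * l) = 2 * k + 4 ∧
        (0 < ![0, 1, 2, 2] t ∨ m = 0) ∧ (0 < ![2, 1, 0, 2] t ∨ l = 0) := by
      obtain h | h | h | h : j = 0 ∨ j = 2 * k + 2 ∨ j % 2 = 1 ∨
          (j % 2 = 0 ∧ j ≠ 0 ∧ j ≠ 2 * k + 2) := by omega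
      · exact ⟨0, 0, k, by simp; omega⟩
      · exact ⟨2, k, 0, by simp; omega⟩
      · exact ⟨1, j / 2, k - j / 2, by simp; omega⟩
      · exact ⟨3, j / 2 - 1, k - j / 2, by simp; omega⟩
    refine (isWitness_link r t).threeEdgeColorable (d := 2 * k) hl hm.1 hm.2 ?_ ?_ ?_
    · omega
    · rintro v i r' h1 h2 h3 h4
      obtain rfl : r = r' := Option.some.inj h3
      simp only [Set.mem_ofPred_eq]
      omega
    · simp
  have first : ∀ r, P (![20, 48, 49] r) (50 + r) := by
    intro r
    refine (isWitness_first r).threeEdgeColorable (d := 2 * k) (k := 0) (l := k) (by omega)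
      (by simp) (by simp) ?_ ?_ ?_
    · rintro v (h | h) h'
      · exact .inl h
      · omega
    · rintro v i r' h1 h2 h3 h4
      obtain rfl : r = r' := Option.some.inj h3
      exact .inr (by omega)
    · simp
  have last : ∀ r, P (![21, 49, 46] r) (50 + 4 * (2 * k + 3) + r) := by
    intro r
    refine (isWitness_last r).threeEdgeColorable (d := 2 * k) (k := k) (l := 0) (by omega)
      (by simp) (by simp) ?_ ?_ ?_
    · rintro v (h | h) h'
      · exact .inl h
      · omega
    · rintro v i r' h1 h2 h3 h4
      obtain rfl : r = r' := Option.some.inj h3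
      exact .inr (by omega)
    · simp
  have leaf : ∀ j < 2 * k + 4, ∀ r i : Fin 3,
      P (50 + 4 * j + r) (nbr (2 * k) (50 + 4 * j + r) i) := by
    intro j hj r i
    obtain rfl | rfl | rfl : i = 0 ∨ i = 1 ∨ i = 2 := by omega
    · rcases j with _ | j
      · have := symm (first r)
        rwa [← nbr_first (2 * k) r] at this
      · rw [nbr_chain_leaf_zero hj]
        exact symm (link j hj r)
    · by_cases hj' : j + 1 < 2 * k + 4
      · rw [nbr_chain_leaf_one hj']
        exact link j hj' r
      · obtain rfl : j = 2 * k + 3 := by omega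
        rw [nbr_last]
        exact symm (last r)
    · rw [nbr_chain_leaf_two hj]
      exact spoke j hj r
  have key : ∀ v < 66 + 4 * (2 * k), ∀ i, P v (nbr (2 * k) v i) := by
    intro v hv
    refine chain_cases (P := fun v => ∀ i, P v (nbr (2 * k) v i)) ?_ ?_ leaf hv
    · intro v hv i
      have hrev : ∀ j < 2 * k + 4, ∀ r : Fin 3, nbr (2 * k) v i = 50 + 4 * j + r →
          P v (nbr (2 * k) v i) := by
        intro j hj r h
        have := leaf j hj r (nbrRev (2 * k) v i)
        rw [← h, nbr_nbrRev (by omega)] at this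
        exact symm this
      rcases nbr_low hv i with ⟨h, h'⟩ | ⟨r, h⟩ | ⟨r, h⟩
      · obtain ⟨e, he, h1⟩ := exists_edgeWitness v hv i h
        rw [h' (2 * k)]
        refine (isWitness_edge e he).threeEdgeColorable (d := 2 * k) (k := k) (l := 0) (by omega)
          (by simp) (by simp) ?_ (by simp) (by simp)
        intro z hz _
        simp only [Set.mem_ofPred_eq]
        omega
      · exact hrev 0 (by omega) r (h _)
      · exact hrev (2 * k + 3) (by omega) r (h _)
    · intro j hj i
      rw [nbr_chain_center hj]
      exact symm (spoke j hj i)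
  rintro u v ⟨i, hi⟩
  have := key u u.isLt i
  rw [hi] at this
  have hY : ({u, v} : Set (Fin (66 + 4 * (2 * k)))) =
      {z : Fin (66 + 4 * (2 * k)) | (z : ℕ) = u ∨ (z : ℕ) = v} := by
    ext z
    simp [Fin.ext_iff]
  rwa [hY]

/-- For every integer `n ≥ 66` with `n ≡ 2 (mod 8)` there exists a
cyclically 5-connected strictly critical snark of order `n` whose girth equals 6. -/
theorem exists_cyclically5Connected_strictlyCritical_snark_girth_six
    (n : ℕ) (hn : n % 8 = 2) (hn66 : 66 ≤ n) :
    ∃ G : SimpleGraph (Fin n),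
      IsSnark G ∧ CyclicallyConnected G 5 ∧ StrictlyCritical G ∧ G.egirth = 6 := by
  obtain ⟨k, rfl⟩ : ∃ k, n = 66 + 4 * (2 * k) := ⟨(n - 66) / 8, by omega⟩
  exact ⟨chainGraph (2 * k), isSnark_chainGraph k, cyclicallyConnected_chainGraph _,
    ⟨critical_chainGraph k, not_bicritical_chainGraph k⟩, egirth_chainGraph k⟩
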